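/- arXiv:math/0212138 — 3 statements merged into one kernel-verified Lean document; each statement's English description precedes it below -/
import Mathlib

section
/- Let H be a group, h ∈ H non-trivial, and n ≥ 2. Write G_{(m)} = H₁ ∗ ⋯ ∗ H_m for the free product of m copies of H, and let ρₙ : Bₙ → Aut(G_{(n)}) and ρ_{n+1} : B_{n+1} → Aut(G_{(n+1)}) be the Artin type representations associated to (H,h). Let ι : Bₙ → B_{n+1} be the homomorphism sending σ_k to σ_k for k = 1, …, n−1. Then for every β ∈ Bₙ, the group Γ_{n+1}(ι(β)·σₙ⁻¹) is isomorphic to Γₙ(β), where Γ_m(γ) denotes the quotient of G_{(m)} by the normal subgroup generated by { g⁻¹ · (ρ_m(γ)(g)) : g ∈ G_{(m)} }. -/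
def braidRels (m : ℕ) : Set (FreeGroup (Fin m)) :=
  { r | (∃ i j : Fin m, (i : ℕ) + 1 = (j : ℕ) ∧
          r = FreeGroup.of i * FreeGroup.of j * FreeGroup.of i *
              (FreeGroup.of j * FreeGroup.of i * FreeGroup.of j)⁻¹) ∨
        (∃ i j : Fin m, (i : ℕ) + 2 ≤ (j : ℕ) ∧
          r = FreeGroup.of i * FreeGroup.of j * (FreeGroup.of j * FreeGroup.of i)⁻¹) }

abbrev BraidGroup (m : ℕ) : Type := PresentedGroup (braidRels m)

def braidGen {m : ℕ} (i : Fin m) : BraidGroup m := PresentedGroup.of i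

def idx0 {n : ℕ} (k : Fin (n - 1)) : Fin n := ⟨k.1, by have := k.2; omega⟩
def idx1 {n : ℕ} (k : Fin (n - 1)) : Fin n := ⟨k.1 + 1, by have := k.2; omega⟩

def IsArtinRep {n : ℕ} {H : Type} [Group H] (h : H)
    (ρ : BraidGroup (n - 1) →* MulAut (Monoid.CoprodI (fun _ : Fin n => H))) : Prop :=
  ∀ k : Fin (n - 1),
    (∀ y : H, ρ (braidGen k) (Monoid.CoprodI.of (i := idx0 k) y) =
        (Monoid.CoprodI.of (i := idx0 k) h)⁻¹ * Monoid.CoprodI.of (i := idx1 k) y *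
          Monoid.CoprodI.of (i := idx0 k) h) ∧
    (∀ y : H, ρ (braidGen k) (Monoid.CoprodI.of (i := idx1 k) y) =
        Monoid.CoprodI.of (i := idx0 k) h * Monoid.CoprodI.of (i := idx0 k) y *
          (Monoid.CoprodI.of (i := idx0 k) h)⁻¹) ∧
    (∀ j : Fin n, j ≠ idx0 k → j ≠ idx1 k →
      ∀ y : H, ρ (braidGen k) (Monoid.CoprodI.of (i := j) y) = Monoid.CoprodI.of (i := j) y)

abbrev artinGamma {n : ℕ} {H : Type} [Group H]
    (ρ : BraidGroup (n - 1) →* MulAut (Monoid.CoprodI (fun _ : Fin n => H)))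
    (β : BraidGroup (n - 1)) : Type :=
  Monoid.CoprodI (fun _ : Fin n => H) ⧸
    Subgroup.normalClosure
      {x : Monoid.CoprodI (fun _ : Fin n => H) |
        ∃ g : Monoid.CoprodI (fun _ : Fin n => H), x = g⁻¹ * ρ β g}

theorem artinGamma_mk_rho {n : ℕ} {H : Type} [Group H]
    (ρ : BraidGroup (n - 1) →* MulAut (Monoid.CoprodI (fun _ : Fin n => H)))
    (β : BraidGroup (n - 1)) (g : Monoid.CoprodI (fun _ : Fin n => H)) :
    (QuotientGroup.mk (ρ β g) : artinGamma ρ β) = QuotientGroup.mk g :=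
  Eq.symm <| QuotientGroup.eq.2 <|
    Subgroup.subset_normalClosure (Set.mem_ofPred.2 ⟨g, rfl⟩)

/-- A homomorphism that coequalizes `ρ β` and the identity descends to `artinGamma ρ β`. -/
def artinGammaLift {n : ℕ} {H K : Type} [Group H] [Group K]
    (ρ : BraidGroup (n - 1) →* MulAut (Monoid.CoprodI (fun _ : Fin n => H)))
    (β : BraidGroup (n - 1)) (f : Monoid.CoprodI (fun _ : Fin n => H) →* K)
    (hf : ∀ g, f (ρ β g) = f g) : artinGamma ρ β →* K :=
  QuotientGroup.lift _ f <| Subgroup.normalClosure_le_normal <| by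
    rintro _ ⟨g, rfl⟩
    simp [MonoidHom.mem_ker, hf]

/-- The inclusion of the free product of `n` copies of `H` as the first `n` factors of `n + 1`. -/
def coprodCastSucc (H : Type) [Group H] (n : ℕ) :
    Monoid.CoprodI (fun _ : Fin n => H) →* Monoid.CoprodI (fun _ : Fin (n + 1) => H) :=
  Monoid.CoprodI.lift fun j => Monoid.CoprodI.of (M := fun _ : Fin (n + 1) => H) (i := j.castSucc)

theorem coprodCastSucc_of {H : Type} [Group H] {n : ℕ} (j : Fin n) (y : H) :
    coprodCastSucc H n (Monoid.CoprodI.of (i := j) y) =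
      Monoid.CoprodI.of (M := fun _ : Fin (n + 1) => H) (i := j.castSucc) y := by
  simp [coprodCastSucc]

/-- The retraction onto the first `n` factors that maps the last factor to the conjugate
by `h` of the factor with index `a`. -/
def coprodRetract {H : Type} [Group H] {n : ℕ} (a : Fin n) (h : H) :
    Monoid.CoprodI (fun _ : Fin (n + 1) => H) →* Monoid.CoprodI (fun _ : Fin n => H) :=
  Monoid.CoprodI.lift <| Fin.lastCases
    ((MulAut.conj (Monoid.CoprodI.of (M := fun _ : Fin n => H) (i := a) h)).toMonoidHom.comp
      (Monoid.CoprodI.of (M := fun _ : Fin n => H) (i := a)))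
    (fun j => Monoid.CoprodI.of (M := fun _ : Fin n => H) (i := j))

theorem coprodRetract_of_last {H : Type} [Group H] {n : ℕ} (a : Fin n) (h y : H) :
    coprodRetract a h (Monoid.CoprodI.of (i := Fin.last n) y) =
      Monoid.CoprodI.of (M := fun _ : Fin n => H) (i := a) h * Monoid.CoprodI.of (i := a) y *
        (Monoid.CoprodI.of (M := fun _ : Fin n => H) (i := a) h)⁻¹ := by
  simp [coprodRetract]

theorem coprodRetract_of_castSucc {H : Type} [Group H] {n : ℕ} (a : Fin n) (h : H) (j : Fin n)
    (y : H) :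
    coprodRetract a h (Monoid.CoprodI.of (i := j.castSucc) y) =
      Monoid.CoprodI.of (M := fun _ : Fin n => H) (i := j) y := by
  simp [coprodRetract]

theorem coprodRetract_coprodCastSucc {H : Type} [Group H] {n : ℕ} (a : Fin n) (h : H)
    (g : Monoid.CoprodI (fun _ : Fin n => H)) :
    coprodRetract a h (coprodCastSucc H n g) = g := by
  suffices (coprodRetract a h).comp (coprodCastSucc H n) = MonoidHom.id _ from
    DFunLike.congr_fun this g
  ext j y
  simp [coprodCastSucc_of, coprodRetract_of_castSucc]

theorem BraidGroup.induction {m : ℕ} {p : BraidGroup m → Prop} (one : p 1)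
    (gen : ∀ k, p (braidGen k)) (mul : ∀ a b, p a → p b → p (a * b))
    (inv : ∀ a, p a → p a⁻¹) (β : BraidGroup m) : p β := by
  have hβ : β ∈ Subgroup.closure (Set.range (PresentedGroup.of (rels := braidRels m))) := by
    simp [PresentedGroup.closure_range_of]
  induction hβ using Subgroup.closure_induction with
  | mem x hx => obtain ⟨k, rfl⟩ := hx; exact gen k
  | one => exact one
  | mul a b _ _ ha hb => exact mul a b ha hb
  | inv a _ ha => exact inv a ha

theorem coprodCastSucc_artinRep {H : Type} [Group H] {h : H} {n : ℕ}
    {ρ₁ : BraidGroup (n - 1) →* MulAut (Monoid.CoprodI (fun _ : Fin n => H))}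
    (hρ₁ : IsArtinRep h ρ₁)
    {ρ₂ : BraidGroup (n + 1 - 1) →* MulAut (Monoid.CoprodI (fun _ : Fin (n + 1) => H))}
    (hρ₂ : IsArtinRep (n := n + 1) h ρ₂)
    {ι : BraidGroup (n - 1) →* BraidGroup (n + 1 - 1)}
    (hι : ∀ k : Fin (n - 1),
      ι (braidGen k) = braidGen (⟨k.1, by have := k.2; omega⟩ : Fin (n + 1 - 1)))
    (β : BraidGroup (n - 1)) (g : Monoid.CoprodI (fun _ : Fin n => H)) :
    ρ₂ (ι β) (coprodCastSucc H n g) = coprodCastSucc H n (ρ₁ β g) := by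
  induction β using BraidGroup.induction generalizing g with
  | one => simp
  | mul a b ha hb => simp [ha, hb]
  | inv a ha =>
    rw [map_inv, map_inv, map_inv, MulAut.inv_apply, MulEquiv.symm_apply_eq, ha,
      MulAut.apply_inv_self]
  | gen k =>
    suffices ((ρ₂ (ι (braidGen k))).toMonoidHom.comp (coprodCastSucc H n)) =
        (coprodCastSucc H n).comp (ρ₁ (braidGen k)).toMonoidHom from DFunLike.congr_fun this g
    ext j y
    obtain ⟨h₁, h₂, h₃⟩ := hρ₁ k
    obtain ⟨h₁', h₂', h₃'⟩ := hρ₂ ⟨k.1, by have := k.2; omega⟩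
    have e₀ : idx0 (n := n + 1) ⟨k.1, by have := k.2; omega⟩ = (idx0 k).castSucc := rfl
    have e₁ : idx1 (n := n + 1) ⟨k.1, by have := k.2; omega⟩ = (idx1 k).castSucc := rfl
    rw [e₀, e₁] at h₁' h₂' h₃'
    simp only [MonoidHom.comp_apply, MulEquiv.coe_toMonoidHom, hι, coprodCastSucc_of]
    by_cases hj₀ : j = idx0 k
    · subst hj₀
      rw [h₁, h₁']
      simp [coprodCastSucc_of]
    by_cases hj₁ : j = idx1 k
    · subst hj₁
      rw [h₂, h₂']
      simp [coprodCastSucc_of]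
    rw [h₃ j hj₀ hj₁, h₃' _ (by simpa using hj₀) (by simpa using hj₁), coprodCastSucc_of]

theorem artinRep_of_last {H : Type} [Group H] {h : H} {n : ℕ}
    {ρ₂ : BraidGroup (n + 1 - 1) →* MulAut (Monoid.CoprodI (fun _ : Fin (n + 1) => H))}
    (hρ₂ : IsArtinRep (n := n + 1) h ρ₂)
    {ι : BraidGroup (n - 1) →* BraidGroup (n + 1 - 1)}
    (hι : ∀ k : Fin (n - 1),
      ι (braidGen k) = braidGen (⟨k.1, by have := k.2; omega⟩ : Fin (n + 1 - 1)))
    (β : BraidGroup (n - 1)) (y : H) :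
    ρ₂ (ι β) (Monoid.CoprodI.of (i := Fin.last n) y) = Monoid.CoprodI.of (i := Fin.last n) y := by
  induction β using BraidGroup.induction with
  | one => simp
  | mul a b ha hb => simp [ha, hb]
  | inv a ha => rw [map_inv, map_inv, MulAut.inv_apply, MulEquiv.symm_apply_eq, ha]
  | gen k =>
    rw [hι]
    have := k.2
    refine (hρ₂ _).2.2 _ ?_ ?_ y <;>
    · simp only [ne_eq, Fin.ext_iff, Fin.val_last, idx0, idx1]
      omega

theorem gamma_stabilization_neg {H : Type} [Group H] (h : H) (hh : h ≠ 1) (n : ℕ) (hn : 2 ≤ n)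
    (ρ₁ : BraidGroup (n - 1) →* MulAut (Monoid.CoprodI (fun _ : Fin n => H)))
    (hρ₁ : IsArtinRep h ρ₁)
    (ρ₂ : BraidGroup (n + 1 - 1) →* MulAut (Monoid.CoprodI (fun _ : Fin (n + 1) => H)))
    (hρ₂ : IsArtinRep (n := n + 1) h ρ₂)
    (ι : BraidGroup (n - 1) →* BraidGroup (n + 1 - 1))
    (hι : ∀ k : Fin (n - 1),
      ι (braidGen k) = braidGen (⟨k.1, by have := k.2; omega⟩ : Fin (n + 1 - 1)))
    (β : BraidGroup (n - 1)) :
    Nonempty (artinGamma (n := n + 1) ρ₂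
        (ι β * (braidGen (⟨n - 1, by omega⟩ : Fin (n + 1 - 1)))⁻¹) ≃*
      artinGamma ρ₁ β) := by
  let a : Fin n := ⟨n - 1, by omega⟩
  set s : Fin (n + 1 - 1) := ⟨n - 1, by omega⟩
  set γ := ι β * (braidGen s)⁻¹ with hγ
  have e₀ : idx0 (n := n + 1) s = a.castSucc := rfl
  have e₁ : idx1 (n := n + 1) s = Fin.last n := by
    simp only [Fin.ext_iff, idx1, Fin.val_last, s]
    omega
  obtain ⟨s₁, s₂, s₃⟩ := hρ₂ s
  rw [e₀, e₁] at s₁ s₂ s₃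
  have hσ (g) : (QuotientGroup.mk (ρ₂ (braidGen s) g) : artinGamma (n := n + 1) ρ₂ γ) =
      QuotientGroup.mk (ρ₂ (ι β) g) := by
    rw [← artinGamma_mk_rho (n := n + 1) ρ₂ γ (ρ₂ (braidGen s) g), hγ, ← MulAut.mul_apply,
      ← map_mul, inv_mul_cancel_right]
  have hlast (y : H) : (QuotientGroup.mk (Monoid.CoprodI.of (M := fun _ : Fin (n + 1) => H)
        (i := Fin.last n) y) : artinGamma (n := n + 1) ρ₂ γ) =
      QuotientGroup.mk (Monoid.CoprodI.of (M := fun _ : Fin (n + 1) => H) (i := a.castSucc) h *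
        Monoid.CoprodI.of (i := a.castSucc) y *
        (Monoid.CoprodI.of (M := fun _ : Fin (n + 1) => H) (i := a.castSucc) h)⁻¹) := by
    rw [← s₂, hσ, artinRep_of_last hρ₂ hι]
  let π₁ : _ →* artinGamma ρ₁ β := QuotientGroup.mk' _
  let π₂ : _ →* artinGamma (n := n + 1) ρ₂ γ := QuotientGroup.mk' _
  have hret : ∀ g, π₁.comp (coprodRetract a h) (ρ₂ γ g) = π₁.comp (coprodRetract a h) g := by
    have key : (π₁.comp (coprodRetract a h)).comp (ρ₂ (ι β)).toMonoidHom =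
        (π₁.comp (coprodRetract a h)).comp (ρ₂ (braidGen s)).toMonoidHom := by
      ext j y
      simp only [MonoidHom.comp_apply, MulEquiv.coe_toMonoidHom]
      induction j using Fin.lastCases with
      | last =>
        rw [artinRep_of_last hρ₂ hι, s₂]
        simp [coprodRetract_of_castSucc, coprodRetract_of_last]
      | cast j =>
        rw [← coprodCastSucc_of, coprodCastSucc_artinRep hρ₁ hρ₂ hι, coprodRetract_coprodCastSucc]
        refine (artinGamma_mk_rho ρ₁ β _).trans (congrArg π₁ ?_)
        rw [coprodCastSucc_of]
        by_cases hj : j = a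
        · subst hj
          rw [s₁]
          simp [coprodRetract_of_castSucc, coprodRetract_of_last, mul_assoc]
        · rw [s₃ _ (by simpa using hj) (Fin.castSucc_lt_last j).ne, coprodRetract_of_castSucc]
    intro g
    have := DFunLike.congr_fun key ((ρ₂ (braidGen s))⁻¹ g)
    simpa [hγ] using this
  have hinc : ∀ g, π₂.comp (coprodCastSucc H n) (ρ₁ β g) = π₂.comp (coprodCastSucc H n) g := by
    intro g
    rw [MonoidHom.comp_apply, ← coprodCastSucc_artinRep hρ₁ hρ₂ hι]
    refine (hσ _).symm.trans ?_
    suffices (π₂.comp (ρ₂ (braidGen s)).toMonoidHom).comp (coprodCastSucc H n) =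
        π₂.comp (coprodCastSucc H n) from DFunLike.congr_fun this g
    ext j y
    simp only [MonoidHom.comp_apply, MulEquiv.coe_toMonoidHom, coprodCastSucc_of]
    by_cases hj : j = a
    · subst hj
      have := hlast y
      change π₂ _ = π₂ _ at this
      rw [s₁, π₂.map_mul, π₂.map_mul, this]
      simp [mul_assoc]
    · rw [s₃ _ (by simpa using hj) (Fin.castSucc_lt_last j).ne]
  refine ⟨MonoidHom.toMulEquiv (artinGammaLift (n := n + 1) ρ₂ γ _ hret)
    (artinGammaLift ρ₁ β _ hinc) (QuotientGroup.monoidHom_ext _ ?_)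
    (QuotientGroup.monoidHom_ext _ ?_)⟩
  · ext j y
    change π₂ (coprodCastSucc H n (coprodRetract a h (Monoid.CoprodI.of y))) =
      π₂ (Monoid.CoprodI.of y)
    induction j using Fin.lastCases with
    | last =>
      refine Eq.trans (congrArg π₂ ?_) (hlast y).symm
      simp [coprodRetract_of_last, coprodCastSucc_of]
    | cast j => rw [coprodRetract_of_castSucc, coprodCastSucc_of]
  · exact MonoidHom.ext fun g => congrArg π₁ (coprodRetract_coprodCastSucc a h g)
end

section
/- Let H be a group and h ∈ H a non-trivial element, and let n ≥ 2. Then the Artin type representation ρ : Bₙ → Aut(G) associated to (H,h), where G = H₁ ∗ ⋯ ∗ Hₙ, is faithful; that is, ρ is an injective group homomorphism. -/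
/-! ### Left self-distributive terms in one generator -/

/-- Terms in one generator and one binary operation. -/
inductive LDTerm : Type
  | gen : LDTerm
  | app : LDTerm → LDTerm → LDTerm

namespace LDTerm

/-- One application of `a (b c) ↦ (a b) (a c)` at some subterm. -/
inductive Step : LDTerm → LDTerm → Prop
  | dist (a b c : LDTerm) : Step (a.app (b.app c)) ((a.app b).app (a.app c))
  | left {a a' : LDTerm} (b : LDTerm) : Step a a' → Step (a.app b) (a'.app b)
  | right (a : LDTerm) {b b' : LDTerm} : Step b b' → Step (a.app b) (a.app b')

/-- `Expands t s`: the term `s` is an LD-expansion of `t`. -/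
abbrev Expands : LDTerm → LDTerm → Prop := Relation.ReflTransGen Step

theorem Expands.app {a a' b b' : LDTerm} (ha : Expands a a') (hb : Expands b b') :
    Expands (a.app b) (a'.app b') :=
  (ha.lift (fun t => t.app b) fun _ _ h => Step.left b h).trans
    (hb.lift (fun t => a'.app t) fun _ _ h => Step.right a' h)

/-- Uniform distribution of `a` over the leaves of a term. -/
def distrib (a : LDTerm) : LDTerm → LDTerm
  | gen => a.app gen
  | app b c => (distrib a b).app (distrib a c)

/-- The common expansion of all one-step expansions of a term. -/
def derive : LDTerm → LDTerm
  | gen => gen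
  | app a b => distrib (derive a) (derive b)

theorem expands_distrib (a b : LDTerm) : Expands (a.app b) (distrib a b) := by
  induction b with
  | gen => exact .refl
  | app b c hb hc => exact .head (.dist a b c) (hb.app hc)

theorem Expands.distrib_left {a a' : LDTerm} (h : Expands a a') (b : LDTerm) :
    Expands (distrib a b) (distrib a' b) := by
  induction b with
  | gen => exact h.app .refl
  | app b c hb hc => exact hb.app hc

theorem Step.distrib_right {b b' : LDTerm} (h : Step b b') (a : LDTerm) :
    Step (distrib a b) (distrib a b') := by
  induction h with
  | dist p q r => exact .dist _ _ _
  | left _ _ ih => exact .left _ ih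
  | right _ _ ih => exact .right _ ih

theorem Expands.distrib {a a' b b' : LDTerm} (ha : Expands a a') (hb : Expands b b') :
    Expands (distrib a b) (distrib a' b') :=
  (ha.distrib_left b).trans (hb.lift _ fun _ _ h => h.distrib_right a')

theorem expands_derive (t : LDTerm) : Expands t t.derive := by
  induction t with
  | gen => exact .refl
  | app a b ha hb => exact (ha.app hb).trans (expands_distrib _ _)

theorem expands_distrib_distrib (a b c : LDTerm) :
    Expands (distrib a (distrib b c)) (distrib (distrib a b) (distrib a c)) := by
  induction c with
  | gen => exact expands_distrib (distrib a b) (a.app gen)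
  | app p q hp hq => exact hp.app hq

theorem Step.target_expands {t t' : LDTerm} (h : Step t t') : Expands t' t.derive := by
  induction h with
  | dist a b c =>
    refine (Expands.app ((Expands.app a.expands_derive b.expands_derive).trans (expands_distrib _ _))
      ((Expands.app a.expands_derive c.expands_derive).trans (expands_distrib _ _))).trans ?_
    exact Expands.distrib (b := b.derive.app c.derive) .refl (expands_distrib _ _)
  | left b _ ih => exact (Expands.app ih b.expands_derive).trans (expands_distrib _ _)
  | right a _ ih => exact (Expands.app a.expands_derive ih).trans (expands_distrib _ _)

theorem Step.derive_expands {t t' : LDTerm} (h : Step t t') : Expands t.derive t'.derive := by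
  induction h with
  | dist a b c => exact expands_distrib_distrib _ _ _
  | left b _ ih => exact ih.distrib .refl
  | right a _ ih => exact Expands.distrib .refl ih

theorem Expands.derive {t t' : LDTerm} (h : Expands t t') : Expands t.derive t'.derive := by
  induction h with
  | refl => exact .refl
  | tail _ hs ih => exact ih.trans hs.derive_expands

theorem Expands.iterate_derive {t t' : LDTerm} (h : Expands t t') (k : ℕ) :
    Expands (LDTerm.derive^[k] t) (LDTerm.derive^[k] t') := by
  induction k with
  | zero => exact h
  | succ k ih => simpa only [Function.iterate_succ_apply'] using ih.derive

theorem expands_iterate_derive (t : LDTerm) (k : ℕ) : Expands t (derive^[k] t) := by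
  induction k with
  | zero => exact .refl
  | succ k ih => simpa only [Function.iterate_succ_apply'] using ih.trans (expands_derive _)

/-- LD-equivalence of terms. -/
abbrev Equivalent : LDTerm → LDTerm → Prop := Relation.EqvGen Step

theorem Equivalent.exists_expands_iterate {t s : LDTerm} (h : Equivalent t s) :
    (∃ k, Expands t (derive^[k] s)) ∧ ∃ k, Expands s (derive^[k] t) := by
  induction h with
  | rel t s h => exact ⟨⟨0, .single h⟩, 1, h.target_expands⟩
  | refl t => exact ⟨⟨0, .refl⟩, 0, .refl⟩
  | symm t s _ ih => exact ih.symm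
  | trans t s r _ _ ih₁ ih₂ =>
    obtain ⟨⟨k, hk⟩, l, hl⟩ := ih₁
    obtain ⟨⟨m, hm⟩, p, hp⟩ := ih₂
    refine ⟨⟨k + m, ?_⟩, p + l, ?_⟩
    · rw [Function.iterate_add_apply]
      exact hk.trans (hm.iterate_derive k)
    · rw [Function.iterate_add_apply]
      exact hp.trans (hl.iterate_derive p)

theorem Equivalent.exists_common_expansion {t s : LDTerm} (h : Equivalent t s) :
    ∃ r, Expands t r ∧ Expands s r :=
  let ⟨k, hk⟩ := h.exists_expands_iterate.1
  ⟨_, hk, s.expands_iterate_derive k⟩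

theorem Equivalent.app {a a' b b' : LDTerm} (ha : Equivalent a a') (hb : Equivalent b b') :
    Equivalent (a.app b) (a'.app b') := by
  refine .trans _ (a'.app b) _ ?_ ?_
  · clear hb
    induction ha with
    | rel _ _ h => exact .rel _ _ (.left b h)
    | refl => exact .refl _
    | symm _ _ _ ih => exact .symm _ _ ih
    | trans _ _ _ _ _ ih₁ ih₂ => exact .trans _ _ _ ih₁ ih₂
  · clear ha
    induction hb with
    | rel _ _ h => exact .rel _ _ (.right a' h)
    | refl => exact .refl _
    | symm _ _ _ ih => exact .symm _ _ ih
    | trans _ _ _ _ _ ih₁ ih₂ => exact .trans _ _ _ ih₁ ih₂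

/-- Right powers of the generator. -/
def rightPow : ℕ → LDTerm
  | 0 => gen
  | k + 1 => gen.app (rightPow k)

/-- Every term is absorbed by all large right powers of the generator. -/
theorem exists_absorb (t : LDTerm) :
    ∃ N, ∀ k, N ≤ k → Equivalent (t.app (rightPow k)) (rightPow (k + 1)) := by
  induction t with
  | gen => exact ⟨0, fun k _ => .refl _⟩
  | app a b ha hb =>
    obtain ⟨M, hM⟩ := ha
    obtain ⟨N, hN⟩ := hb
    refine ⟨M + N + 1, fun k hk => ?_⟩
    obtain ⟨j, rfl⟩ : ∃ j, k = j + 1 := ⟨k - 1, by omega⟩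
    have h₁ : Equivalent ((a.app b).app (rightPow (j + 1))) ((a.app b).app (a.app (rightPow j))) :=
      Equivalent.app (.refl _) (.symm _ _ (hM j (by omega)))
    have h₂ : Equivalent ((a.app b).app (a.app (rightPow j))) (a.app (b.app (rightPow j))) :=
      .symm _ _ (.rel _ _ (.dist a b _))
    have h₃ : Equivalent (a.app (b.app (rightPow j))) (a.app (rightPow (j + 1))) :=
      Equivalent.app (.refl _) (hN j (by omega))
    exact .trans _ _ _ h₁ (.trans _ _ _ h₂ (.trans _ _ _ h₃ (hM (j + 1) (by omega))))

/-- `IsPrefix s t`: the term `s` is an iterated left subterm of `t`. -/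
inductive IsPrefix (s : LDTerm) : LDTerm → Prop
  | refl : IsPrefix s s
  | app {t : LDTerm} (r : LDTerm) : IsPrefix s t → IsPrefix s (t.app r)

theorem IsPrefix.total {s s' t : LDTerm} (h : IsPrefix s t) (h' : IsPrefix s' t) :
    IsPrefix s s' ∨ IsPrefix s' s := by
  induction h with
  | refl => exact .inr h'
  | app r h ih =>
    cases h' with
    | refl => exact .inl (.app r h)
    | app _ h' => exact ih h'

theorem IsPrefix.step {s t t' : LDTerm} (h : IsPrefix s t) (ht : Step t t') :
    ∃ s', Expands s s' ∧ IsPrefix s' t' := by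
  induction ht with
  | dist a b c =>
    cases h with
    | refl => exact ⟨_, .single (.dist a b c), .refl⟩
    | app _ h => exact ⟨s, .refl, (h.app b).app _⟩
  | left b hs ih =>
    cases h with
    | refl => exact ⟨_, .single (.left b hs), .refl⟩
    | app _ h =>
      obtain ⟨s', h₁, h₂⟩ := ih h
      exact ⟨s', h₁, h₂.app b⟩
  | right a hs ih =>
    cases h with
    | refl => exact ⟨_, .single (.right a hs), .refl⟩
    | app _ h => exact ⟨s, .refl, h.app _⟩

theorem IsPrefix.expands {s t t' : LDTerm} (h : IsPrefix s t) (ht : Expands t t') :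
    ∃ s', Expands s s' ∧ IsPrefix s' t' := by
  induction ht with
  | refl => exact ⟨s, .refl, h⟩
  | tail _ hs ih =>
    obtain ⟨s', h₁, h₂⟩ := ih
    obtain ⟨s'', h₃, h₄⟩ := h₂.step hs
    exact ⟨s'', h₁.trans h₃, h₄⟩

/-- Up to expansion, any two terms are comparable for the prefix order. -/
theorem exists_expands_isPrefix (s t : LDTerm) :
    ∃ s' t', Expands s s' ∧ Expands t t' ∧ (IsPrefix s' t' ∨ IsPrefix t' s') := by
  obtain ⟨M, hM⟩ := s.exists_absorb
  obtain ⟨N, hN⟩ := t.exists_absorb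
  obtain ⟨r, hs, ht⟩ := Equivalent.exists_common_expansion
    (.trans _ _ _ (hM (M + N) (by omega)) (.symm _ _ (hN (M + N) (by omega))))
  obtain ⟨s', hs₁, hs₂⟩ := (IsPrefix.refl.app _).expands hs
  obtain ⟨t', ht₁, ht₂⟩ := (IsPrefix.refl.app _).expands ht
  exact ⟨s', t', hs₁, ht₁, hs₂.total ht₂⟩

end LDTerm

/-! ### The braid group on infinitely many strands -/

/-- The braid relations on generators indexed by `ℕ`. -/
def infBraidRels : Set (FreeGroup ℕ) :=
  { r | (∃ i, r = FreeGroup.of i * FreeGroup.of (i + 1) * FreeGroup.of i *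
              (FreeGroup.of (i + 1) * FreeGroup.of i * FreeGroup.of (i + 1))⁻¹) ∨
        (∃ i j, i + 2 ≤ j ∧
          r = FreeGroup.of i * FreeGroup.of j * (FreeGroup.of j * FreeGroup.of i)⁻¹) }

/-- The braid group on infinitely many strands. -/
abbrev InfBraidGroup : Type := PresentedGroup infBraidRels

namespace InfBraidGroup

/-- The standard generators. -/
def gen (i : ℕ) : InfBraidGroup := PresentedGroup.of i

theorem gen_braid (i : ℕ) : gen i * gen (i + 1) * gen i = gen (i + 1) * gen i * gen (i + 1) := by
  rw [← mul_inv_eq_one]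
  exact PresentedGroup.one_of_mem (rels := infBraidRels) (.inl ⟨i, rfl⟩)

theorem gen_commute {i j : ℕ} (h : i + 2 ≤ j) : Commute (gen i) (gen j) := by
  rw [Commute, SemiconjBy, ← mul_inv_eq_one]
  exact PresentedGroup.one_of_mem (rels := infBraidRels) (.inr ⟨i, j, h, rfl⟩)

section lift

variable {G : Type*} [Group G] (f : ℕ → G)
  (h₁ : ∀ i, f i * f (i + 1) * f i = f (i + 1) * f i * f (i + 1))
  (h₂ : ∀ i j, i + 2 ≤ j → f i * f j = f j * f i)

/-- The universal property of `InfBraidGroup`. -/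
def lift : InfBraidGroup →* G :=
  PresentedGroup.toGroup (f := f) (by
    rintro r (⟨i, rfl⟩ | ⟨i, j, hij, rfl⟩)
    · rw [map_mul, map_inv, mul_inv_eq_one]
      simpa using h₁ i
    · rw [map_mul, map_inv, mul_inv_eq_one]
      simpa using h₂ i j hij)

@[simp]
theorem lift_gen (i : ℕ) : lift f h₁ h₂ (gen i) = f i :=
  PresentedGroup.toGroup.of _

end lift

theorem induction_on {P : InfBraidGroup → Prop} (x : InfBraidGroup) (one : P 1)
    (gen : ∀ i, P (gen i)) (inv_gen : ∀ i, P (InfBraidGroup.gen i)⁻¹)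
    (mul : ∀ x y, P x → P y → P (x * y)) : P x := by
  induction x using PresentedGroup.induction_on with
  | _ z =>
    induction z using FreeGroup.induction_on with
    | C1 => simpa using one
    | of i => exact gen i
    | inv_of i _ => rw [map_inv]; exact inv_gen i
    | mul x y hx hy => rw [map_mul]; exact mul _ _ hx hy

/-- The shift endomorphism `gen i ↦ gen (i + 1)`. -/
def shift : InfBraidGroup →* InfBraidGroup :=
  lift (fun i => gen (i + 1)) (fun i => gen_braid (i + 1))
    fun _ _ h => gen_commute (by omega)

@[simp]
theorem shift_gen (i : ℕ) : shift (gen i) = gen (i + 1) := lift_gen _ _ _ i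

theorem commute_gen_zero_shift_shift (x : InfBraidGroup) :
    Commute (gen 0) (shift (shift x)) := by
  induction x using induction_on with
  | one => simp
  | gen i => simpa using gen_commute (by omega)
  | inv_gen i => simpa using gen_commute (by omega)
  | mul x y hx hy => simpa using hx.mul_right hy

/-- Dehornoy's self-distributive operation on braids. -/
def ld (x y : InfBraidGroup) : InfBraidGroup := x * shift y * gen 0 * (shift x)⁻¹

theorem ld_ld (x y z : InfBraidGroup) : ld x (ld y z) = ld (ld x y) (ld x z) := by
  have hx := commute_gen_zero_shift_shift x
  have hy := commute_gen_zero_shift_shift y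
  have hz := commute_gen_zero_shift_shift z
  have hb : gen 1 * gen 0 = gen 0 * gen 1 * gen 0 * (gen 1)⁻¹ := by
    rw [eq_mul_inv_iff_mul_eq]; exact (gen_braid 0).symm
  simp only [ld, map_mul, map_inv, shift_gen, zero_add, mul_inv_rev, inv_inv]
  calc x * (shift y * shift (shift z) * gen 1 * (shift (shift y))⁻¹) * gen 0 * (shift x)⁻¹
      = x * shift y * shift (shift z) * gen 1 * ((shift (shift y))⁻¹ * gen 0) * (shift x)⁻¹ := by
        group
    _ = x * shift y * shift (shift z) * (gen 1 * gen 0) * (shift (shift y))⁻¹ * (shift x)⁻¹ := by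
        rw [← hy.inv_right.eq]; group
    _ = x * shift y * (shift (shift z) * gen 0) * gen 1 * gen 0 * (gen 1)⁻¹ *
          (shift (shift y))⁻¹ * (shift x)⁻¹ := by rw [hb]; group
    _ = x * shift y * gen 0 * shift (shift z) * gen 1 * (shift (shift x))⁻¹ *
          (shift (shift x) * gen 0) * (gen 1)⁻¹ * (shift (shift y))⁻¹ * (shift x)⁻¹ := by
        rw [← hz.eq]; group
    _ = _ := by rw [← hx.eq]; group

/-- Evaluation of terms at the trivial braid. -/
def eval : LDTerm → InfBraidGroup
  | .gen => 1
  | .app s t => ld (eval s) (eval t)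

theorem eval_step {s t : LDTerm} (h : LDTerm.Step s t) : eval s = eval t := by
  induction h with
  | dist a b c => exact ld_ld _ _ _
  | left b _ ih => simp only [eval, ih]
  | right a _ ih => simp only [eval, ih]

theorem eval_expands {s t : LDTerm} (h : LDTerm.Expands s t) : eval s = eval t := by
  induction h with
  | refl => rfl
  | tail _ hs ih => rw [ih, eval_step hs]

/-- Braids with an expression in which `gen 0` does not occur with a negative exponent. -/
def nonnegative : Submonoid InfBraidGroup :=
  Submonoid.closure ({gen 0} ∪ Set.range shift)

theorem gen_zero_mem_nonnegative : gen 0 ∈ nonnegative :=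
  Submonoid.subset_closure (.inl rfl)

theorem shift_mem_nonnegative (x : InfBraidGroup) : shift x ∈ nonnegative :=
  Submonoid.subset_closure (.inr ⟨x, rfl⟩)

/-- Braids with an expression in which `gen 0` occurs, and only with positive exponents. -/
def Positive (x : InfBraidGroup) : Prop :=
  ∃ a ∈ nonnegative, ∃ b ∈ nonnegative, x = a * gen 0 * b

theorem Positive.mul_right {x y : InfBraidGroup} (hx : Positive x) (hy : y ∈ nonnegative) :
    Positive (x * y) := by
  obtain ⟨a, ha, b, hb, rfl⟩ := hx
  exact ⟨a, ha, b * y, mul_mem hb hy, by group⟩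

theorem Positive.mul_left {x y : InfBraidGroup} (hx : Positive x) (hy : y ∈ nonnegative) :
    Positive (y * x) := by
  obtain ⟨a, ha, b, hb, rfl⟩ := hx
  exact ⟨y * a, mul_mem hy ha, b, hb, by group⟩

theorem Positive.mem_nonnegative {x : InfBraidGroup} (hx : Positive x) : x ∈ nonnegative := by
  obtain ⟨a, ha, b, hb, rfl⟩ := hx
  exact mul_mem (mul_mem ha gen_zero_mem_nonnegative) hb

theorem positive_inv_mul_ld (x y : InfBraidGroup) : Positive (x⁻¹ * ld x y) :=
  ⟨shift y, shift_mem_nonnegative y, shift x⁻¹, shift_mem_nonnegative _, by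
    simp only [ld, map_inv]; group⟩

theorem eval_of_isPrefix {s t : LDTerm} (h : LDTerm.IsPrefix s t) :
    eval s = eval t ∨ Positive ((eval s)⁻¹ * eval t) := by
  induction h with
  | refl => exact .inl rfl
  | @app t r h ih =>
    right
    have key := positive_inv_mul_ld (eval t) (eval r)
    rcases ih with ih | ih
    · rwa [ih]
    · have := key.mul_left ih.mem_nonnegative
      simpa [eval, mul_assoc] using this

theorem eval_trichotomy (s t : LDTerm) :
    eval s = eval t ∨ Positive ((eval s)⁻¹ * eval t) ∨ Positive ((eval t)⁻¹ * eval s) := by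
  obtain ⟨s', t', hs, ht, h⟩ := LDTerm.exists_expands_isPrefix s t
  rw [eval_expands hs, eval_expands ht]
  rcases h with h | h
  · rcases eval_of_isPrefix h with h | h <;> simp [h]
  · rcases eval_of_isPrefix h with h | h <;> simp [h]

/-- Products `eval t₀ * shift (eval t₁) * shift² (eval t₂) * ⋯` in which the first `k` factors are
values of terms, and the remaining part is arbitrary. -/
inductive IsShiftProduct : ℕ → InfBraidGroup → Prop
  | zero (x : InfBraidGroup) : IsShiftProduct 0 x
  | succ {k : ℕ} {x : InfBraidGroup} (t : LDTerm) :
    IsShiftProduct k x → IsShiftProduct (k + 1) (eval t * shift x)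

theorem IsShiftProduct.one (k : ℕ) : IsShiftProduct k 1 := by
  induction k with
  | zero => exact .zero 1
  | succ k ih => simpa [eval] using ih.succ .gen

theorem IsShiftProduct.mul_gen {k : ℕ} {x : InfBraidGroup} (h : IsShiftProduct k x) {i : ℕ}
    (hi : i + 1 < k) : IsShiftProduct k (x * gen i) := by
  induction h generalizing i with
  | zero x => omega
  | @succ k x t h ih =>
    cases i with
    | succ i =>
      have := (ih (i := i) (by omega)).succ t
      simpa [mul_assoc] using this
    | zero =>
      cases h with
      | zero => omega
      | @succ k x s h =>
        have := (h.succ t).succ (t.app s)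
        convert this using 1
        have hx := commute_gen_zero_shift_shift x
        simp only [eval, ld, map_mul]
        calc eval t * (shift (eval s) * shift (shift x)) * gen 0
            = eval t * shift (eval s) * (shift (shift x) * gen 0) := by group
          _ = _ := by rw [← hx.eq]; group

/-- The submonoid generated by the first `N` standard generators. -/
def positiveMonoid (N : ℕ) : Submonoid InfBraidGroup :=
  Submonoid.closure (gen '' Set.Iio N)

theorem gen_mem_positiveMonoid {N i : ℕ} (h : i < N) : gen i ∈ positiveMonoid N :=
  Submonoid.subset_closure ⟨i, h, rfl⟩

theorem positiveMonoid_mono {M N : ℕ} (h : M ≤ N) : positiveMonoid M ≤ positiveMonoid N :=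
  Submonoid.closure_mono (Set.image_mono fun _ hi => lt_of_lt_of_le hi h)

theorem isShiftProduct_of_mem {N : ℕ} {x : InfBraidGroup} (h : x ∈ positiveMonoid N) :
    IsShiftProduct (N + 1) x := by
  induction h using Submonoid.closure_induction_right with
  | one => exact .one _
  | mul_right x _ y hy ih =>
    obtain ⟨i, hi, rfl⟩ := hy
    exact ih.mul_gen (Nat.succ_lt_succ hi)

theorem exists_eval_mul_shift {N : ℕ} {x : InfBraidGroup} (h : x ∈ positiveMonoid N) :
    ∃ t y, x = eval t * shift y := by
  cases isShiftProduct_of_mem h with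
  | succ t _ => exact ⟨t, _, rfl⟩

/-- The braid in which strand `k` winds once around all the previous ones. -/
def wind : ℕ → InfBraidGroup
  | 0 => 1
  | k + 1 => gen k * wind k * gen k

theorem wind_mem (k : ℕ) : wind k ∈ positiveMonoid k := by
  induction k with
  | zero => exact one_mem _
  | succ k ih =>
    have hk := gen_mem_positiveMonoid (Nat.lt_succ_self k)
    exact mul_mem (mul_mem hk (positiveMonoid_mono (Nat.le_succ k) ih)) hk

theorem commute_of_mem_positiveMonoid {N : ℕ} {x y : InfBraidGroup} (hx : x ∈ positiveMonoid N)
    (h : ∀ i < N, Commute (gen i) y) : Commute x y := by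
  induction hx using Submonoid.closure_induction with
  | mem x hx => obtain ⟨i, hi, rfl⟩ := hx; exact h i hi
  | one => exact .one_left y
  | mul a b _ _ ha hb => exact ha.mul_left hb

theorem commute_gen_wind_of_lt {k j : ℕ} (h : k < j) : Commute (gen j) (wind k) :=
  (commute_of_mem_positiveMonoid (wind_mem k) fun _ _ => gen_commute (by omega)).symm

theorem commute_gen_wind {k j : ℕ} (h : j + 1 < k) : Commute (gen j) (wind k) := by
  induction k with
  | zero => omega
  | succ k ih =>
    obtain hj | rfl : j + 1 < k ∨ k = j + 1 := by omega
    · have := gen_commute (show j + 2 ≤ k by omega)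
      exact (this.mul_right (ih hj)).mul_right this
    · have hw := commute_gen_wind_of_lt (Nat.lt_succ_self j)
      have hb := gen_braid j
      simp only [wind]
      rw [Commute, SemiconjBy]
      calc gen j * (gen (j + 1) * (gen j * wind j * gen j) * gen (j + 1))
          = (gen j * gen (j + 1) * gen j) * wind j * gen j * gen (j + 1) := by group
        _ = gen (j + 1) * gen j * (gen (j + 1) * wind j) * gen j * gen (j + 1) := by
            rw [hb]; group
        _ = gen (j + 1) * gen j * wind j * (gen (j + 1) * gen j * gen (j + 1)) := by
            rw [hw.eq]; group
        _ = _ := by rw [← hb]; group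

/-- The full twist on `k + 1` strands. -/
def fullTwist : ℕ → InfBraidGroup
  | 0 => 1
  | k + 1 => fullTwist k * wind (k + 1)

theorem fullTwist_mem (k : ℕ) : fullTwist k ∈ positiveMonoid k := by
  induction k with
  | zero => exact one_mem _
  | succ k ih => exact mul_mem (positiveMonoid_mono (Nat.le_succ k) ih) (wind_mem _)

theorem commute_gen_fullTwist {k j : ℕ} (h : j < k) : Commute (gen j) (fullTwist k) := by
  induction k with
  | zero => omega
  | succ k ih =>
    obtain hj | rfl : j < k ∨ k = j := by omega
    · exact (ih hj).mul_right (commute_gen_wind (by omega))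
    · cases k with
      | zero => simp [fullTwist, wind]
      | succ k =>
        have h₁ : Commute (gen (k + 1)) (fullTwist k) :=
          (commute_of_mem_positiveMonoid (fullTwist_mem k) fun _ _ =>
            gen_commute (by omega)).symm
        have h₂ : Commute (wind (k + 1)) (wind (k + 2)) :=
          commute_of_mem_positiveMonoid (wind_mem (k + 1)) fun _ _ =>
            commute_gen_wind (by omega)
        simp only [fullTwist, mul_assoc]
        refine h₁.mul_right ?_
        rw [Commute, SemiconjBy, h₂.eq]
        nth_rewrite 1 [h₂.symm.eq]
        simp only [wind, mul_assoc]

theorem exists_mul_gen_eq_fullTwist {N i : ℕ} (h : i < N) :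
    ∃ q ∈ positiveMonoid N, q * gen i = fullTwist N := by
  obtain ⟨p, hp, r, hr, hpr⟩ : ∃ p ∈ positiveMonoid N, ∃ r ∈ positiveMonoid N,
      p * gen i * r = fullTwist N := by
    induction N with
    | zero => omega
    | succ N ih =>
      obtain hi | rfl : i < N ∨ i = N := by omega
      · obtain ⟨p, hp, r, hr, h⟩ := ih hi
        exact ⟨p, positiveMonoid_mono (Nat.le_succ N) hp, r * wind (N + 1),
          mul_mem (positiveMonoid_mono (Nat.le_succ N) hr) (wind_mem _), by
            rw [fullTwist, ← h]; group⟩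
      · have hi := Nat.le_succ i
        exact ⟨fullTwist i, positiveMonoid_mono hi (fullTwist_mem i), wind i * gen i,
          mul_mem (positiveMonoid_mono hi (wind_mem i))
            (gen_mem_positiveMonoid (Nat.lt_succ_self i)), by
            simp only [fullTwist, wind]; group⟩
  refine ⟨r * p, mul_mem hr hp, ?_⟩
  have hc : Commute r (fullTwist N) :=
    commute_of_mem_positiveMonoid hr fun _ hj => commute_gen_fullTwist hj
  have : p * gen i = fullTwist N * r⁻¹ := by rw [← hpr]; group
  rw [mul_assoc, this, ← mul_assoc, hc.eq]
  group

/-- Braids that are fractions `a⁻¹ * b` of positive braids on `N + 1` strands. -/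
def IsFraction (N : ℕ) (x : InfBraidGroup) : Prop :=
  ∃ a ∈ positiveMonoid N, ∃ b ∈ positiveMonoid N, x = a⁻¹ * b

theorem IsFraction.mul_inv_gen {N i : ℕ} {x : InfBraidGroup} (hx : IsFraction N x) (h : i < N) :
    IsFraction N (x * (gen i)⁻¹) := by
  obtain ⟨a, ha, b, hb, rfl⟩ := hx
  obtain ⟨q, hq, hqi⟩ := exists_mul_gen_eq_fullTwist h
  refine ⟨fullTwist N * a, mul_mem (fullTwist_mem N) ha, b * q, mul_mem hb hq, ?_⟩
  have hc : Commute b (fullTwist N) :=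
    commute_of_mem_positiveMonoid hb fun _ hj => commute_gen_fullTwist hj
  have : q = fullTwist N * (gen i)⁻¹ := by rw [← hqi]; group
  rw [this, ← mul_assoc b, hc.eq]
  group

theorem IsFraction.mono {M N : ℕ} (h : M ≤ N) {x : InfBraidGroup} (hx : IsFraction M x) :
    IsFraction N x := by
  obtain ⟨a, ha, b, hb, rfl⟩ := hx
  exact ⟨a, positiveMonoid_mono h ha, b, positiveMonoid_mono h hb, rfl⟩

theorem exists_isFraction (x : InfBraidGroup) : ∃ N, IsFraction N x := by
  suffices ∀ x y, (∃ N, IsFraction N y) → ∃ N, IsFraction N (y * x) by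
    simpa using this x 1 ⟨0, 1, one_mem _, 1, one_mem _, by simp⟩
  intro x
  induction x using induction_on with
  | one => simp
  | gen i =>
    rintro y ⟨N, hy⟩
    obtain ⟨a, ha, b, hb, rfl⟩ := hy.mono (le_max_left N (i + 1))
    exact ⟨max N (i + 1), a, ha, b * gen i,
      mul_mem hb (gen_mem_positiveMonoid (by omega)), by group⟩
  | inv_gen i =>
    rintro y ⟨N, hy⟩
    exact ⟨max N (i + 1), (hy.mono (le_max_left N (i + 1))).mul_inv_gen (by omega)⟩
  | mul x y hx hy =>
    intro z hz
    simpa [mul_assoc] using hy _ (hx z hz)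

/-- Every braid is positive, the inverse of a positive braid, or a shifted braid. -/
theorem trichotomy (x : InfBraidGroup) : x ∈ shift.range ∨ Positive x ∨ Positive x⁻¹ := by
  obtain ⟨N, a, ha, b, hb, rfl⟩ := exists_isFraction x
  obtain ⟨s, c, rfl⟩ := exists_eval_mul_shift ha
  obtain ⟨t, d, rfl⟩ := exists_eval_mul_shift hb
  rcases eval_trichotomy s t with h | h | h
  · left
    exact ⟨c⁻¹ * d, by rw [h, map_mul, map_inv]; group⟩
  · right; left
    convert (h.mul_left (shift_mem_nonnegative c⁻¹)).mul_right (shift_mem_nonnegative d) using 1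
    rw [map_inv]; group
  · right; right
    convert (h.mul_left (shift_mem_nonnegative d⁻¹)).mul_right (shift_mem_nonnegative c) using 1
    rw [map_inv]; group

end InfBraidGroup

/-! ### Artin twists of a free product of copies of a group -/

/-- The free product of copies of `H` indexed by `ι`. -/
abbrev FreePower (ι H : Type*) [Group H] : Type _ := Monoid.CoprodI (fun _ : ι => H)

namespace FreePower

/-- The canonical embeddings of the factors. -/
abbrev letter {ι H : Type*} [Group H] (i : ι) : H →* FreePower ι H :=
  Monoid.CoprodI.of (M := fun _ : ι => H) (i := i)

section headIdx

variable {ι H : Type*} [Group H]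

theorem hom_ext {G : Type*} [Monoid G] {f g : FreePower ι H →* G}
    (hfg : ∀ j y, f (letter j y) = g (letter j y)) : f = g :=
  Monoid.CoprodI.ext_hom _ _ fun j => MonoidHom.ext (hfg j)

open scoped Classical in
/-- The index of the first syllable of the normal form of an element. -/
noncomputable def headIdx (g : FreePower ι H) : Option ι :=
  (Monoid.CoprodI.Word.equiv g).fstIdx

theorem headIdx_one : headIdx (1 : FreePower ι H) = none := by
  classical
  have : Monoid.CoprodI.Word.equiv (1 : FreePower ι H) = Monoid.CoprodI.Word.empty :=
    Monoid.CoprodI.Word.equiv.symm.injective <|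
      (Monoid.CoprodI.Word.equiv.symm_apply_apply _).trans Monoid.CoprodI.Word.prod_empty.symm
  rw [headIdx]
  convert congrArg Monoid.CoprodI.Word.fstIdx this
  rfl

theorem headIdx_letter_mul {i : ι} {y : H} {g : FreePower ι H} (hy : y ≠ 1)
    (hg : headIdx g ≠ some i) : headIdx (letter i y * g) = some i := by
  classical
  have hg' : (Monoid.CoprodI.Word.equiv g).fstIdx ≠ some i := by rw [headIdx] at hg; convert hg
  have : Monoid.CoprodI.Word.equiv (letter i y * g) =
      Monoid.CoprodI.Word.cons y (Monoid.CoprodI.Word.equiv g) hg' hy := by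
    refine Monoid.CoprodI.Word.equiv.symm.injective ?_
    rw [Equiv.symm_apply_apply]
    refine Eq.trans ?_ (Monoid.CoprodI.Word.prod_cons i y _ hy hg').symm
    exact congrArg _ (Monoid.CoprodI.Word.equiv.symm_apply_apply g).symm
  rw [headIdx]
  convert congrArg Monoid.CoprodI.Word.fstIdx this
  simp

theorem reduced_induction {P : FreePower ι H → Prop} (one : P 1)
    (mul : ∀ i y g, y ≠ 1 → headIdx g ≠ some i → P g → P (letter i y * g)) (g : FreePower ι H) :
    P g := by
  classical
  suffices ∀ w : Monoid.CoprodI.Word (fun _ : ι => H), P w.prod by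
    have h := this (Monoid.CoprodI.Word.equiv g)
    rwa [show (Monoid.CoprodI.Word.equiv g).prod = g from
      Monoid.CoprodI.Word.equiv.symm_apply_apply g] at h
  intro w
  induction w using Monoid.CoprodI.Word.consRecOn with
  | empty => simpa using one
  | cons i y w h₁ h₂ ih =>
    rw [Monoid.CoprodI.Word.prod_cons]
    refine mul i y _ h₂ ?_ ih
    rw [headIdx]
    convert h₁
    exact Monoid.CoprodI.Word.equiv.apply_symm_apply w

theorem headIdx_eq_none {g : FreePower ι H} : headIdx g = none ↔ g = 1 := by
  refine ⟨fun h => ?_, fun h => h ▸ headIdx_one⟩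
  induction g using reduced_induction with
  | one => rfl
  | mul i y g hy hg _ => simp [headIdx_letter_mul hy hg] at h

end headIdx

section twist

variable {ι H : Type*} [DecidableEq ι] [Group H]

/-- The endomorphism sending factor `a` to factor `b` and vice versa, conjugated by `h` in
factor `a`. -/
def twist (a b : ι) (h : H) : FreePower ι H →* FreePower ι H :=
  Monoid.CoprodI.lift fun j =>
    if j = a then (MulAut.conj (letter a h)⁻¹).toMonoidHom.comp (letter b)
    else if j = b then (MulAut.conj (letter a h)).toMonoidHom.comp (letter a)
    else letter j

theorem twist_left (a b : ι) (h y : H) :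
    twist a b h (letter a y) = (letter a h)⁻¹ * letter b y * letter a h := by
  simp [twist, letter]

theorem twist_right {a b : ι} (hab : a ≠ b) (h y : H) :
    twist a b h (letter b y) = letter a h * letter a y * (letter a h)⁻¹ := by
  simp [twist, letter, hab.symm]

theorem twist_of_ne {a b j : ι} (ha : j ≠ a) (hb : j ≠ b) (h y : H) :
    twist a b h (letter j y) = letter j y := by
  simp [twist, letter, ha, hb]

theorem twist_comp_twist {a b : ι} (hab : a ≠ b) (h : H) :
    (twist b a h⁻¹).comp (twist a b h) = MonoidHom.id (FreePower ι H) := by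
  refine hom_ext fun j y => ?_
  rw [MonoidHom.comp_apply, MonoidHom.id_apply]
  obtain rfl | ha := eq_or_ne j a
  · simp only [twist_left, twist_right hab.symm, map_mul, map_inv]
    group
  obtain rfl | hb := eq_or_ne j b
  · simp only [twist_right hab, twist_right hab.symm, map_mul, map_inv]
    group
  · rw [twist_of_ne ha hb, twist_of_ne hb ha]

/-- `twist` as an automorphism. -/
def twistAut {a b : ι} (hab : a ≠ b) (h : H) : MulAut (FreePower ι H) :=
  MonoidHom.toMulEquiv (twist a b h) (twist b a h⁻¹) (twist_comp_twist hab h)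
    (by simpa using twist_comp_twist hab.symm h⁻¹)

theorem twistAut_apply {a b : ι} (hab : a ≠ b) (h : H) (g : FreePower ι H) :
    twistAut hab h g = twist a b h g := rfl

theorem headIdx_twist {a b : ι} (hab : a ≠ b) {h : H} (hh : h ≠ 1) (g : FreePower ι H) :
    (headIdx g = some a → ∃ y v, y ≠ 1 ∧ headIdx v ≠ some b ∧
      twist a b h g = letter a h⁻¹ * (letter b y * v)) ∧
    (headIdx g = some b → headIdx (letter a h * twist a b h g) ≠ some b ∧
      (headIdx (twist a b h g) = some a ∨ headIdx (twist a b h g) = some b)) ∧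
    (∀ j, j ≠ a → j ≠ b → headIdx g = some j → headIdx (twist a b h g) = some j) := by
  induction g using reduced_induction with
  | one => simp [headIdx_one]
  | mul i y g hy hg ih =>
    obtain ⟨iha, ihb, ihj⟩ := ih
    have cases_head : g = 1 ∨ headIdx g = some a ∨ headIdx g = some b ∨
        ∃ j, j ≠ a ∧ j ≠ b ∧ headIdx g = some j := by
      cases hgi : headIdx g with
      | none => exact .inl (headIdx_eq_none.1 hgi)
      | some j =>
        by_cases ha : j = a
        · simp [ha]
        by_cases hb : j = b
        · simp [hb]
        exact .inr (.inr (.inr ⟨j, ha, hb, rfl⟩))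
    have some_ne {j k : ι} (hjk : j ≠ k) : some j ≠ some k := fun e => hjk (Option.some.inj e)
    rw [headIdx_letter_mul hy hg]
    refine ⟨fun hi => ?_, fun hi => ?_, fun j hja hjb hi => ?_⟩ <;>
      obtain rfl := Option.some.inj hi
    · refine ⟨y, letter i h * twist i b h g, hy, ?_, ?_⟩
      · rcases cases_head with rfl | hgi | hgi | ⟨j, hja, hjb, hgj⟩
        · rw [map_one, headIdx_letter_mul hh (by simp [headIdx_one])]
          exact some_ne hab
        · exact absurd hgi hg
        · exact (ihb hgi).1
        · rw [headIdx_letter_mul hh (by rw [ihj j hja hjb hgj]; exact some_ne hja)]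
          exact some_ne hab
      · rw [map_mul, twist_left, map_inv]
        group
    · have hconj (z : H) : letter a z * twist a i h (letter i y * g) =
          letter a (z * (h * y * h⁻¹)) * twist a i h g := by
        simp only [map_mul, twist_right hab, map_inv, mul_assoc]
      have hone := hconj 1
      rw [map_one, one_mul, one_mul] at hone
      rw [hconj, hone]
      have hy' : h * y * h⁻¹ ≠ 1 := by simpa using hy
      have generic {v : FreePower ι H} (hva : headIdx v ≠ some a) (hvi : headIdx v ≠ some i)
          (z : H) : headIdx (letter a z * v) ≠ some i := by
        by_cases hz : z = 1
        · simpa [hz] using hvi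
        · rw [headIdx_letter_mul hz hva]
          exact some_ne hab
      rcases cases_head with rfl | hgi | hgi | ⟨j, hja, hjb, hgj⟩
      · rw [map_one]
        exact ⟨generic (by simp [headIdx_one]) (by simp [headIdx_one]) _,
          .inl (headIdx_letter_mul hy' (by simp [headIdx_one]))⟩
      · obtain ⟨x, v, hx, hv, hxv⟩ := iha hgi
        have hhead := headIdx_letter_mul hx hv
        have ha : headIdx (letter i x * v) ≠ some a := by
          rw [hhead]; exact some_ne hab.symm
        rw [hxv, ← mul_assoc, ← map_mul, ← mul_assoc (letter a (h * y * h⁻¹)), ← map_mul]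
        constructor
        · have hz : h * (h * y * h⁻¹) * h⁻¹ ≠ 1 := by simpa using hy
          rw [headIdx_letter_mul hz ha]
          exact some_ne hab
        · by_cases hz : h * y * h⁻¹ * h⁻¹ = 1
          · right; rw [hz, map_one, one_mul, hhead]
          · left; exact headIdx_letter_mul hz ha
      · exact absurd hgi hg
      · have hj := ihj j hja hjb hgj
        have ha : headIdx (twist a i h g) ≠ some a := by rw [hj]; exact some_ne hja
        have hi : headIdx (twist a i h g) ≠ some i := by rw [hj]; exact some_ne hjb
        exact ⟨generic ha hi _, .inl (headIdx_letter_mul hy' ha)⟩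
    · rw [map_mul, twist_of_ne hja hjb]
      refine headIdx_letter_mul hy ?_
      rcases cases_head with rfl | hgi | hgi | ⟨j, hka, hkb, hgj⟩
      · simp [headIdx_one]
      · obtain ⟨x, v, hx, hv, hxv⟩ := iha hgi
        rw [hxv, headIdx_letter_mul (by simpa using hh)
          (by rw [headIdx_letter_mul hx hv]; exact some_ne hab.symm)]
        exact some_ne hja.symm
      · rcases (ihb hgi).2 with e | e <;> rw [e]
        · exact some_ne hja.symm
        · exact some_ne hjb.symm
      · rw [ihj j hka hkb hgj, ← hgj]
        exact hg

theorem headIdx_twist_ne {a b j : ι} (hab : a ≠ b) {h : H} (hh : h ≠ 1) (ha : j ≠ a)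
    (hb : j ≠ b) {g : FreePower ι H} (hg : headIdx g ≠ some j) :
    headIdx (twist a b h g) ≠ some j := by
  obtain ⟨h₁, h₂, h₃⟩ := headIdx_twist hab hh g
  cases hgi : headIdx g with
  | none => simp [headIdx_eq_none.1 hgi, headIdx_one]
  | some i =>
    obtain rfl | hia := eq_or_ne i a
    · obtain ⟨y, v, hy, hv, e⟩ := h₁ hgi
      have hne : headIdx (letter b y * v) ≠ some i := by
        simpa [headIdx_letter_mul hy hv] using hab.symm
      rw [e, headIdx_letter_mul (by simpa using hh) hne]
      simpa using ha.symm
    obtain rfl | hib := eq_or_ne i b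
    · rcases (h₂ hgi).2 with e | e <;> rw [e]
      · simpa using ha.symm
      · simpa using hb.symm
    · rw [h₃ i hia hib hgi, ← hgi]
      exact hg

end twist

end FreePower

/-! ### The Artin type representation on infinitely many strands -/

namespace InfBraidGroup

open FreePower

section rep

variable {H : Type*} [Group H] (h : H)

/-- The Artin type representation of the braid group on infinitely many strands. -/
def rep : InfBraidGroup →* MulAut (FreePower ℕ H) :=
  lift (fun i => twistAut (Nat.ne_of_lt (Nat.lt_succ_self i)) h)
    (fun i => by
      have h₀ : i ≠ i + 1 := by omega
      have h₁ : i + 1 ≠ i + 1 + 1 := by omega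
      refine MulEquiv.toMonoidHom_injective (hom_ext fun j y => ?_)
      simp only [MulEquiv.coe_toMonoidHom, MulAut.mul_apply, twistAut_apply]
      have h₂ : i ≠ i + 1 + 1 := by omega
      obtain rfl | ha := eq_or_ne j i
      · simp only [twist_left, twist_right h₀, map_mul, map_inv,
          twist_of_ne h₀ h₂, twist_of_ne h₂.symm h₁.symm]
        group
      obtain rfl | hb := eq_or_ne j (i + 1)
      · simp only [twist_left, twist_right h₁, twist_right h₀, map_mul, map_inv,
          twist_of_ne h₀ h₂, twist_of_ne h₂.symm h₁.symm]
        group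
      obtain rfl | hc := eq_or_ne j (i + 1 + 1)
      · simp only [twist_right h₁, twist_right h₀, map_mul, map_inv,
          twist_of_ne h₀ h₂, twist_of_ne h₂.symm h₁.symm]
      · simp only [twist_of_ne ha hb, twist_of_ne hb hc])
    (fun i k hik => by
      have h₀ : i ≠ i + 1 := by omega
      have h₁ : k ≠ k + 1 := by omega
      have h₂ : i ≠ k := by omega
      have h₃ : i ≠ k + 1 := by omega
      have h₄ : i + 1 ≠ k := by omega
      have h₅ : i + 1 ≠ k + 1 := by omega
      refine MulEquiv.toMonoidHom_injective (hom_ext fun j y => ?_)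
      simp only [MulEquiv.coe_toMonoidHom, MulAut.mul_apply, twistAut_apply]
      by_cases hi : j = i ∨ j = i + 1
      · rcases hi with rfl | rfl <;>
          simp only [twist_left, twist_right h₀, map_mul, map_inv, twist_of_ne h₂ h₃,
            twist_of_ne h₄ h₅]
      rw [not_or] at hi
      by_cases hk : j = k ∨ j = k + 1
      · rcases hk with rfl | rfl <;>
          simp only [twist_left, twist_right h₁, map_mul, map_inv, twist_of_ne hi.1 hi.2,
            twist_of_ne h₂.symm h₄.symm, twist_of_ne h₃.symm h₅.symm]
      rw [not_or] at hk
      simp only [twist_of_ne hi.1 hi.2, twist_of_ne hk.1 hk.2])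

theorem rep_gen (i : ℕ) (g : FreePower ℕ H) : rep h (gen i) g = twist i (i + 1) h g := by
  rw [rep, lift_gen]; rfl

theorem rep_inv_gen (i : ℕ) (g : FreePower ℕ H) :
    rep h (gen i)⁻¹ g = twist (i + 1) i h⁻¹ g := by
  rw [rep, map_inv, lift_gen]; rfl

theorem rep_shift_letter_zero (x : InfBraidGroup) (y : H) :
    rep h (shift x) (letter 0 y) = letter 0 y := by
  induction x using induction_on with
  | one => simp
  | gen i => rw [shift_gen, rep_gen, twist_of_ne (by omega) (by omega)]
  | inv_gen i => rw [map_inv, shift_gen, rep_inv_gen, twist_of_ne (by omega) (by omega)]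
  | mul x z hx hz => rw [map_mul, map_mul, MulAut.mul_apply, hz, hx]

theorem headIdx_rep_shift_ne (hh : h ≠ 1) (x : InfBraidGroup) {g : FreePower ℕ H}
    (hg : headIdx g ≠ some 0) : headIdx (rep h (shift x) g) ≠ some 0 := by
  induction x using induction_on generalizing g with
  | one => simpa using hg
  | gen i =>
    rw [shift_gen, rep_gen]
    exact headIdx_twist_ne (by omega) hh (by omega) (by omega) hg
  | inv_gen i =>
    rw [map_inv, shift_gen, rep_inv_gen]
    exact headIdx_twist_ne (by omega) (inv_ne_one.2 hh) (by omega) (by omega) hg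
  | mul x z hx hz =>
    rw [map_mul, map_mul, MulAut.mul_apply]
    exact hx (hz hg)

/-- Elements whose normal form has at least two syllables, the first one being `h⁻¹` in factor
`0`. -/
def StartsWithInv (g : FreePower ℕ H) : Prop :=
  ∃ v, v ≠ 1 ∧ headIdx v ≠ some 0 ∧ g = letter 0 h⁻¹ * v

theorem startsWithInv_rep_gen_zero (hh : h ≠ 1) {g : FreePower ℕ H} (hg : headIdx g = some 0) :
    StartsWithInv h (rep h (gen 0) g) := by
  rw [rep_gen]
  obtain ⟨y, v, hy, hv, e⟩ := (headIdx_twist (Nat.zero_ne_one) hh g).1 hg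
  have hhead := headIdx_letter_mul hy hv
  refine ⟨letter 1 y * v, fun h₁ => ?_, by simp [hhead], e⟩
  simp [headIdx_eq_none.2 h₁] at hhead

theorem StartsWithInv.headIdx_eq {h : H} (hh : h ≠ 1) {g : FreePower ℕ H}
    (hg : StartsWithInv h g) : headIdx g = some 0 := by
  obtain ⟨v, -, hv, rfl⟩ := hg
  exact headIdx_letter_mul (inv_ne_one.2 hh) hv

theorem not_startsWithInv_letter_zero : ¬ StartsWithInv h (letter 0 h) := by
  rintro ⟨v, hv, hv₀, e⟩
  have e : v = letter 0 (h * h) := by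
    rw [← inv_mul_eq_iff_eq_mul, ← map_inv, inv_inv, ← map_mul] at e
    exact e.symm
  by_cases h₁ : h * h = 1
  · exact hv (by rw [e, h₁, map_one])
  · refine hv₀ ?_
    rw [e, ← mul_one (letter 0 (h * h)), headIdx_letter_mul h₁ (by simp [headIdx_one])]

theorem rep_mem_of_nonnegative (hh : h ≠ 1) {x : InfBraidGroup} (hx : x ∈ nonnegative) :
    (∀ g, StartsWithInv h g → StartsWithInv h (rep h x g)) ∧
      (rep h x (letter 0 h) = letter 0 h ∨ StartsWithInv h (rep h x (letter 0 h))) := by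
  induction hx using Submonoid.closure_induction with
  | mem x hx =>
    rcases hx with rfl | ⟨y, rfl⟩
    · refine ⟨fun g hg => startsWithInv_rep_gen_zero h hh (hg.headIdx_eq hh), .inr ?_⟩
      refine startsWithInv_rep_gen_zero h hh ?_
      rw [← mul_one (letter 0 h), headIdx_letter_mul hh (by simp [headIdx_one])]
    · refine ⟨?_, .inl (rep_shift_letter_zero h y h)⟩
      rintro g ⟨v, hv, hv₀, rfl⟩
      refine ⟨rep h (shift y) v, by simpa using hv, headIdx_rep_shift_ne h hh y hv₀, ?_⟩
      rw [map_mul, rep_shift_letter_zero]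
  | one => simp
  | mul x y _ _ hx hy =>
    simp only [map_mul, MulAut.mul_apply]
    refine ⟨fun g hg => hx.1 _ (hy.1 g hg), ?_⟩
    rcases hy.2 with e | e
    · rw [e]; exact hx.2
    · exact .inr (hx.1 _ e)

theorem Positive.rep_ne_one {x : InfBraidGroup} (hx : Positive x) (hh : h ≠ 1) :
    rep h x ≠ 1 := by
  obtain ⟨a, ha, b, hb, rfl⟩ := hx
  intro e
  have e := DFunLike.congr_fun e (letter 0 h)
  simp only [map_mul, MulAut.mul_apply, MulAut.one_apply] at e
  refine not_startsWithInv_letter_zero h ?_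
  rw [← e]
  refine (rep_mem_of_nonnegative h hh ha).1 _ (startsWithInv_rep_gen_zero h hh ?_)
  rcases (rep_mem_of_nonnegative h hh hb).2 with e | e
  · rw [e, ← mul_one (letter 0 h), headIdx_letter_mul hh (by simp [headIdx_one])]
  · exact e.headIdx_eq hh

/-- The index shift of the infinite free product. -/
def shiftHom : FreePower ℕ H →* FreePower ℕ H :=
  Monoid.CoprodI.lift fun j => letter (j + 1)

theorem shiftHom_letter (j : ℕ) (y : H) : shiftHom (letter j y) = letter (j + 1) y := by
  simp [shiftHom, letter]

theorem shiftHom_injective : Function.Injective (shiftHom : FreePower ℕ H →* FreePower ℕ H) := by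
  let r : FreePower ℕ H →* FreePower ℕ H := Monoid.CoprodI.lift fun j => letter (j - 1)
  have hr : r.comp shiftHom = MonoidHom.id _ := hom_ext fun j y => by
    rw [MonoidHom.comp_apply, shiftHom_letter]
    simp [r, letter]
  exact Function.LeftInverse.injective (g := r) fun g => DFunLike.congr_fun hr g

theorem shiftHom_twist {a b : ℕ} (hab : a ≠ b) (g : FreePower ℕ H) :
    shiftHom (twist a b h g) = twist (a + 1) (b + 1) h (shiftHom g) := by
  have : shiftHom.comp (twist a b h) = (twist (a + 1) (b + 1) h).comp shiftHom := by
    refine hom_ext fun j y => ?_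
    simp only [MonoidHom.comp_apply]
    obtain rfl | ha := eq_or_ne j a
    · simp only [twist_left, map_mul, map_inv, shiftHom_letter]
    obtain rfl | hb := eq_or_ne j b
    · simp only [twist_right hab, twist_right (show a + 1 ≠ j + 1 by omega), map_mul, map_inv,
        shiftHom_letter]
    · rw [twist_of_ne ha hb, shiftHom_letter, twist_of_ne (by omega) (by omega)]
  exact DFunLike.congr_fun this g

theorem shiftHom_rep (x : InfBraidGroup) (g : FreePower ℕ H) :
    shiftHom (rep h x g) = rep h (shift x) (shiftHom g) := by
  induction x using induction_on generalizing g with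
  | one => simp
  | gen i => rw [shift_gen, rep_gen, rep_gen, shiftHom_twist h (by omega)]
  | inv_gen i =>
    rw [map_inv shift, shift_gen, rep_inv_gen, rep_inv_gen, shiftHom_twist h⁻¹ (by omega)]
  | mul x z hx hz => simp only [map_mul, MulAut.mul_apply, hx, hz]

theorem rep_eq_one_of_shift {x : InfBraidGroup} (hx : rep h (shift x) = 1) : rep h x = 1 := by
  ext g
  refine shiftHom_injective ?_
  rw [shiftHom_rep, hx]
  rfl

/-- A braid acting trivially is a shift, by any amount. -/
theorem exists_iterate_shift_eq (hh : h ≠ 1) (k : ℕ) {x : InfBraidGroup} (hx : rep h x = 1) :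
    ∃ y, shift^[k] y = x := by
  induction k generalizing x with
  | zero => exact ⟨x, rfl⟩
  | succ k ih =>
    rcases trichotomy x with ⟨y, rfl⟩ | hp | hp
    · obtain ⟨z, rfl⟩ := ih (rep_eq_one_of_shift h hx)
      exact ⟨z, Function.iterate_succ_apply' _ _ _⟩
    · exact absurd hx (hp.rep_ne_one h hh)
    · exact absurd (by rw [map_inv, hx, inv_one]) (hp.rep_ne_one h hh)

end rep

end InfBraidGroup

/-! ### Forgetting strands -/

section BraidGroup

variable {m : ℕ}

theorem braidGen_braid {i j : Fin m} (h : (i : ℕ) + 1 = j) :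
    braidGen i * braidGen j * braidGen i = braidGen j * braidGen i * braidGen j :=
  mul_inv_eq_one.1 <| PresentedGroup.one_of_mem (rels := braidRels m) (.inl ⟨i, j, h, rfl⟩)

theorem braidGen_commute {i j : Fin m} (h : (i : ℕ) + 2 ≤ j) :
    braidGen i * braidGen j = braidGen j * braidGen i :=
  mul_inv_eq_one.1 <| PresentedGroup.one_of_mem (rels := braidRels m) (.inr ⟨i, j, h, rfl⟩)

theorem BraidGroup.induction_on {P : BraidGroup m → Prop} (β : BraidGroup m) (one : P 1)
    (gen : ∀ i, P (braidGen i)) (mul : ∀ β γ, P β → P γ → P (β * γ))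
    (inv : ∀ β, P β → P β⁻¹) : P β := by
  have hβ : β ∈ Subgroup.closure (Set.range (PresentedGroup.of (rels := braidRels m))) := by
    rw [PresentedGroup.closure_range_of]; trivial
  induction hβ using Subgroup.closure_induction with
  | mem x hx => obtain ⟨i, rfl⟩ := hx; exact gen i
  | one => exact one
  | mul x y _ _ hx hy => exact mul x y hx hy
  | inv x _ hx => exact inv x hx

/-- The generators of the braid group, extended by `1` to all indices. -/
def padGen (m k : ℕ) : BraidGroup m := if hk : k < m then braidGen ⟨k, hk⟩ else 1

theorem padGen_of_lt {k : ℕ} (hk : k < m) : padGen m k = braidGen ⟨k, hk⟩ := dif_pos hk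

theorem padGen_braid {k : ℕ} (hk : k + 1 < m) :
    padGen m k * padGen m (k + 1) * padGen m k =
      padGen m (k + 1) * padGen m k * padGen m (k + 1) := by
  rw [padGen_of_lt hk, padGen_of_lt (Nat.lt_of_succ_lt hk)]
  exact braidGen_braid rfl

theorem padGen_commute {k l : ℕ} (hkl : k + 2 ≤ l) :
    padGen m k * padGen m l = padGen m l * padGen m k := by
  by_cases hl : l < m
  · rw [padGen_of_lt hl, padGen_of_lt (k := k) (by omega)]
    exact braidGen_commute hkl
  · simp [padGen, hl]

/-- The inclusion of a braid group in the one on infinitely many strands. -/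
def BraidGroup.embed : BraidGroup m →* InfBraidGroup :=
  PresentedGroup.toGroup (f := fun i : Fin m => InfBraidGroup.gen i) <| by
    rintro r (⟨i, j, h, rfl⟩ | ⟨i, j, h, rfl⟩)
    · simp only [map_mul, map_inv, FreeGroup.lift_apply_of, ← h]
      exact mul_inv_eq_one.2 (InfBraidGroup.gen_braid i)
    · simp only [map_mul, map_inv, FreeGroup.lift_apply_of]
      exact mul_inv_eq_one.2 (InfBraidGroup.gen_commute h)

theorem BraidGroup.embed_braidGen (i : Fin m) : embed (braidGen i) = InfBraidGroup.gen i :=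
  PresentedGroup.toGroup.of _

end BraidGroup

section marking

/-- The number of marked strands among the first `k`. -/
abbrev markCount (S : ℕ → Bool) (k : ℕ) : ℕ := Nat.count (fun j => S j = true) k

theorem markCount_succ (S : ℕ → Bool) (k : ℕ) :
    markCount S (k + 1) = markCount S k + if S k = true then 1 else 0 :=
  Nat.count_succ _ _

/-- Exchanging positions `i` and `i + 1` in a marking. -/
def swapMarks (i : ℕ) (S : ℕ → Bool) : ℕ → Bool := fun j => S (Equiv.swap i (i + 1) j)

theorem swapMarks_left (i : ℕ) (S : ℕ → Bool) : swapMarks i S i = S (i + 1) := by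
  simp [swapMarks]

theorem swapMarks_right (i : ℕ) (S : ℕ → Bool) : swapMarks i S (i + 1) = S i := by
  simp [swapMarks]

theorem swapMarks_of_ne {i j : ℕ} (h₀ : j ≠ i) (h₁ : j ≠ i + 1) (S : ℕ → Bool) :
    swapMarks i S j = S j := by
  rw [swapMarks, Equiv.swap_apply_of_ne_of_ne h₀ h₁]

theorem swapMarks_swapMarks (i : ℕ) (S : ℕ → Bool) : swapMarks i (swapMarks i S) = S := by
  funext j; simp [swapMarks]

theorem swapMarks_eq_self {i : ℕ} {S : ℕ → Bool} (h : S i = S (i + 1)) : swapMarks i S = S := by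
  funext j
  obtain rfl | h₀ := eq_or_ne j i
  · rw [swapMarks_left, h]
  obtain rfl | h₁ := eq_or_ne j (i + 1)
  · rw [swapMarks_right, h]
  · exact swapMarks_of_ne h₀ h₁ S

theorem swapMarks_braid (i : ℕ) (S : ℕ → Bool) :
    swapMarks i (swapMarks (i + 1) (swapMarks i S)) =
      swapMarks (i + 1) (swapMarks i (swapMarks (i + 1) S)) := by
  funext j
  simp only [swapMarks, Equiv.swap_apply_def]
  congr 1
  split_ifs <;> omega

theorem swapMarks_commute {i k : ℕ} (h : i + 2 ≤ k) (S : ℕ → Bool) :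
    swapMarks i (swapMarks k S) = swapMarks k (swapMarks i S) := by
  funext j
  simp only [swapMarks, Equiv.swap_apply_def]
  congr 1
  split_ifs <;> omega

theorem markCount_swapMarks {i k : ℕ} (h : k ≠ i + 1) (S : ℕ → Bool) :
    markCount (swapMarks i S) k = markCount S k := by
  have below (k : ℕ) (hk : k ≤ i) : markCount (swapMarks i S) k = markCount S k := by
    induction k with
    | zero => simp
    | succ k ih =>
      rw [markCount_succ, markCount_succ, ih (by omega), swapMarks_of_ne (by omega) (by omega)]
  have above (k : ℕ) :
      markCount (swapMarks i S) (i + 1 + 1 + k) = markCount S (i + 1 + 1 + k) := by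
    induction k with
    | zero =>
      simp only [Nat.add_zero, markCount_succ, below i le_rfl, swapMarks_left, swapMarks_right]
      omega
    | succ k ih =>
      rw [← Nat.add_assoc, markCount_succ, markCount_succ, ih,
        swapMarks_of_ne (by omega) (by omega)]
  obtain hk | hk := Nat.lt_or_ge i k
  · obtain ⟨l, rfl⟩ := Nat.exists_eq_add_of_le (show i + 1 + 1 ≤ k by omega)
    exact above l
  · exact below k hk

/-- A marking with at most `m + 1` marked strands. -/
def MarkBounded (m : ℕ) (S : ℕ → Bool) : Prop := ∀ k, markCount S k ≤ m + 1

theorem MarkBounded.swapMarks {m : ℕ} {S : ℕ → Bool} (h : MarkBounded m S) (i : ℕ) :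
    MarkBounded m (swapMarks i S) := by
  intro k
  obtain rfl | hk := eq_or_ne k (i + 1)
  · refine (Nat.count_monotone _ (Nat.le_succ _)).trans ?_
    exact (markCount_swapMarks (by omega) S).trans_le (h _)
  · exact (markCount_swapMarks hk S).trans_le (h k)

theorem markBounded_swapMarks {m i : ℕ} {S : ℕ → Bool} :
    MarkBounded m (swapMarks i S) ↔ MarkBounded m S :=
  ⟨fun h => swapMarks_swapMarks i S ▸ h.swapMarks i, fun h => h.swapMarks i⟩

open scoped Classical in
/-- The braid on marked strands induced by the crossing of strands `i` and `i + 1`. -/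
noncomputable def crossing (m : ℕ) (S : ℕ → Bool) (i : ℕ) : BraidGroup m :=
  if MarkBounded m S ∧ S i ∧ S (i + 1) then padGen m (markCount S i) else 1

theorem crossing_braid (m i : ℕ) (S : ℕ → Bool) :
    crossing m (swapMarks (i + 1) (swapMarks i S)) i * crossing m (swapMarks i S) (i + 1) *
        crossing m S i =
      crossing m (swapMarks i (swapMarks (i + 1) S)) (i + 1) *
        crossing m (swapMarks (i + 1) S) i * crossing m S (i + 1) := by
  by_cases hS : MarkBounded m S
  · have h₀ : i ≠ i + 1 := by omega
    have h₁ : i ≠ i + 1 + 1 := by omega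
    have h₂ := hS (i + 1 + 1 + 1)
    simp only [markCount_succ] at h₂
    simp only [crossing, markBounded_swapMarks, hS, true_and, swapMarks_left, swapMarks_right,
      swapMarks_of_ne h₀ h₁, swapMarks_of_ne h₁.symm (show i + 1 + 1 ≠ i + 1 by omega),
      markCount_succ, markCount_swapMarks h₀, markCount_swapMarks h₁]
    cases hi : S i <;> cases hj : S (i + 1) <;> cases hk : S (i + 1 + 1) <;>
      simp [hi, hj, hk] at h₂ ⊢
    exact padGen_braid (by omega)
  · simp [crossing, markBounded_swapMarks, hS]

theorem crossing_swapMarks_of_lt {m i k : ℕ} (h : i + 2 ≤ k) (S : ℕ → Bool) :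
    crossing m (swapMarks k S) i = crossing m S i := by
  rw [crossing, crossing, markBounded_swapMarks, markCount_swapMarks (by omega),
    swapMarks_of_ne (by omega) (by omega), swapMarks_of_ne (by omega) (by omega)]

theorem crossing_swapMarks_of_gt {m i k : ℕ} (h : i + 2 ≤ k) (S : ℕ → Bool) :
    crossing m (swapMarks i S) k = crossing m S k := by
  rw [crossing, crossing, markBounded_swapMarks, markCount_swapMarks (by omega),
    swapMarks_of_ne (by omega) (by omega), swapMarks_of_ne (by omega) (by omega)]

theorem crossing_commute (m : ℕ) {i k : ℕ} (h : i + 2 ≤ k) (S : ℕ → Bool) :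
    crossing m S i * crossing m S k = crossing m S k * crossing m S i := by
  rw [crossing, crossing]
  split_ifs with hi hk
  · refine padGen_commute (le_trans ?_ (Nat.count_monotone _ h))
    change _ ≤ markCount S (i + 1 + 1)
    simp [markCount_succ, hi.2.1, hi.2.2]
  all_goals simp

/-- The action of a crossing on markings and braids on the marked strands. -/
noncomputable def crossingPerm (m i : ℕ) : Equiv.Perm ((ℕ → Bool) × BraidGroup m) where
  toFun p := (swapMarks i p.1, crossing m p.1 i * p.2)
  invFun p := (swapMarks i p.1, (crossing m (swapMarks i p.1) i)⁻¹ * p.2)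
  left_inv p := by simp [swapMarks_swapMarks]
  right_inv p := by simp [swapMarks_swapMarks]

theorem crossingPerm_apply (m i : ℕ) (S : ℕ → Bool) (β : BraidGroup m) :
    crossingPerm m i (S, β) = (swapMarks i S, crossing m S i * β) := rfl

/-- The action of braids on infinitely many strands on markings and braids on the marked
strands. -/
noncomputable def forget (m : ℕ) :
    InfBraidGroup →* Equiv.Perm ((ℕ → Bool) × BraidGroup m) :=
  InfBraidGroup.lift (crossingPerm m)
    (fun i => Equiv.ext fun ⟨S, β⟩ => by
      simp only [Equiv.Perm.mul_apply, crossingPerm_apply, swapMarks_braid, ← mul_assoc,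
        crossing_braid])
    (fun i k h => Equiv.ext fun ⟨S, β⟩ => by
      simp only [Equiv.Perm.mul_apply, crossingPerm_apply, swapMarks_commute h, ← mul_assoc,
        crossing_swapMarks_of_lt h, crossing_swapMarks_of_gt h, crossing_commute m h])

/-- The marking of the first `m + 1` strands. -/
def initialMarks (m : ℕ) : ℕ → Bool := fun j => decide (j < m + 1)

theorem markCount_initialMarks (m k : ℕ) : markCount (initialMarks m) k = min k (m + 1) := by
  induction k with
  | zero => simp
  | succ k ih =>
    rw [markCount_succ, ih]
    simp only [initialMarks, decide_eq_true_eq]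
    split_ifs <;> omega

theorem forget_gen_of_lt {m i : ℕ} (hi : i < m) (β : BraidGroup m) :
    forget m (InfBraidGroup.gen i) (initialMarks m, β) =
      (initialMarks m, braidGen ⟨i, hi⟩ * β) := by
  have h₀ : initialMarks m i = true := by simp [initialMarks]; omega
  have h₁ : initialMarks m (i + 1) = true := by simp [initialMarks]; omega
  have hb : MarkBounded m (initialMarks m) := fun k => by
    rw [markCount_initialMarks]; exact min_le_right _ _
  rw [forget, InfBraidGroup.lift_gen, crossingPerm_apply, swapMarks_eq_self (h₀.trans h₁.symm),
    crossing, if_pos ⟨hb, h₀, h₁⟩, markCount_initialMarks, min_eq_left (by omega),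
    padGen_of_lt hi]

theorem forget_gen_of_gt {m i : ℕ} (hi : m < i) (β : BraidGroup m) :
    forget m (InfBraidGroup.gen i) (initialMarks m, β) = (initialMarks m, β) := by
  have h₀ : initialMarks m i = false := by simp [initialMarks]; omega
  have h₁ : initialMarks m (i + 1) = false := by simp [initialMarks]; omega
  rw [forget, InfBraidGroup.lift_gen, crossingPerm_apply, swapMarks_eq_self (h₀.trans h₁.symm),
    crossing, if_neg (by simp [h₀]), one_mul]

theorem forget_embed {m : ℕ} (β γ : BraidGroup m) :
    forget m β.embed (initialMarks m, γ) = (initialMarks m, β * γ) := by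
  induction β using BraidGroup.induction_on generalizing γ with
  | one => simp
  | gen i => rw [BraidGroup.embed_braidGen, forget_gen_of_lt i.2]
  | mul β β' h h' => rw [map_mul, map_mul, Equiv.Perm.mul_apply, h', h, mul_assoc]
  | inv β h => rw [map_inv, map_inv, Equiv.Perm.inv_eq_iff_eq, h, mul_inv_cancel_left]

theorem iterate_shift_gen (k i : ℕ) :
    InfBraidGroup.shift^[k] (InfBraidGroup.gen i) = InfBraidGroup.gen (i + k) := by
  induction k with
  | zero => rfl
  | succ k ih => rw [Function.iterate_succ_apply', ih, InfBraidGroup.shift_gen, add_assoc]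

theorem forget_iterate_shift {m k : ℕ} (hk : m < k) (x : InfBraidGroup) (γ : BraidGroup m) :
    forget m (InfBraidGroup.shift^[k] x) (initialMarks m, γ) = (initialMarks m, γ) := by
  induction x using InfBraidGroup.induction_on with
  | one => simp
  | gen i => rw [iterate_shift_gen, forget_gen_of_gt (by omega)]
  | inv_gen i =>
    rw [iterate_map_inv, iterate_shift_gen, map_inv, Equiv.Perm.inv_eq_iff_eq,
      forget_gen_of_gt (by omega)]
  | mul x y hx hy => rw [iterate_map_mul, map_mul, Equiv.Perm.mul_apply, hy, hx]

/-- A braid on `m + 1` strands whose image is a shift by at least `m + 1` is trivial. -/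
theorem BraidGroup.eq_one_of_embed_eq {m k : ℕ} (hk : m < k) {β : BraidGroup m}
    {x : InfBraidGroup} (h : InfBraidGroup.shift^[k] x = β.embed) : β = 1 := by
  have e := forget_embed β 1
  rw [← h, forget_iterate_shift hk, mul_one] at e
  exact (congrArg Prod.snd e).symm

end marking

section compatibility

open FreePower InfBraidGroup

variable {n : ℕ} {H : Type} [Group H] {h : H}
  {ρ : BraidGroup (n - 1) →* MulAut (Monoid.CoprodI (fun _ : Fin n => H))}

/-- The inclusion of a finite free power in the infinite one. -/
def inclusion (n : ℕ) (H : Type) [Group H] : FreePower (Fin n) H →* FreePower ℕ H :=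
  Monoid.CoprodI.lift fun j => letter (j : ℕ)

theorem inclusion_letter (j : Fin n) (y : H) :
    inclusion n H (letter j y) = letter (j : ℕ) y := by
  simp [inclusion, letter]

theorem IsArtinRep.rep_embed_inclusion (hρ : IsArtinRep h ρ) (β : BraidGroup (n - 1))
    (g : FreePower (Fin n) H) :
    rep h β.embed (inclusion n H g) = inclusion n H (ρ β g) := by
  induction β using BraidGroup.induction_on generalizing g with
  | one => simp
  | gen k =>
    obtain ⟨h₀, h₁, h₂⟩ := hρ k
    suffices (rep h (gen k)).toMonoidHom.comp (inclusion n H) =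
        (inclusion n H).comp (ρ (braidGen k)).toMonoidHom by
      rw [BraidGroup.embed_braidGen]
      exact DFunLike.congr_fun this g
    refine hom_ext fun j y => ?_
    simp only [MonoidHom.comp_apply, MulEquiv.coe_toMonoidHom, inclusion_letter, rep_gen]
    obtain rfl | hj₀ := eq_or_ne j (idx0 k)
    · rw [h₀]
      simp only [map_mul, map_inv, inclusion_letter]
      exact twist_left _ _ h y
    obtain rfl | hj₁ := eq_or_ne j (idx1 k)
    · rw [h₁]
      simp only [map_mul, map_inv, inclusion_letter]
      exact twist_right (Nat.ne_of_lt (Nat.lt_succ_self _)) h y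
    · rw [h₂ j hj₀ hj₁, inclusion_letter]
      exact twist_of_ne (fun e => hj₀ (Fin.ext e)) (fun e => hj₁ (Fin.ext e)) h y
  | mul β γ hβ hγ => simp only [map_mul, MulAut.mul_apply, hβ, hγ]
  | inv β hβ =>
    rw [map_inv, map_inv, map_inv, MulAut.inv_apply, MulEquiv.symm_apply_eq, hβ,
      MulAut.apply_inv_self]

theorem rep_embed_letter (h : H) (β : BraidGroup (n - 1)) {j : ℕ} (hj : n ≤ j) (y : H) :
    rep h β.embed (letter j y) = letter j y := by
  induction β using BraidGroup.induction_on with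
  | one => simp
  | gen k =>
    rw [BraidGroup.embed_braidGen, rep_gen, twist_of_ne (by omega) (by omega)]
  | mul β γ hβ hγ => rw [map_mul, map_mul, MulAut.mul_apply, hγ, hβ]
  | inv β hβ => rw [map_inv, map_inv, MulAut.inv_apply, MulEquiv.symm_apply_eq, hβ]

theorem IsArtinRep.rep_embed_eq_one (hρ : IsArtinRep h ρ) {β : BraidGroup (n - 1)}
    (hβ : ρ β = 1) : rep h β.embed = 1 := by
  refine MulEquiv.toMonoidHom_injective (hom_ext fun j y => ?_)
  change rep h β.embed (letter j y) = letter j y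
  obtain hj | hj := Nat.lt_or_ge j n
  · have e := hρ.rep_embed_inclusion β (letter ⟨j, hj⟩ y)
    rwa [hβ, MulAut.one_apply, inclusion_letter] at e
  · exact rep_embed_letter h β hj y

end compatibility

theorem artin_rep_faithful {H : Type} [Group H] (h : H) (hh : h ≠ 1) (n : ℕ) (hn : 2 ≤ n)
    (ρ : BraidGroup (n - 1) →* MulAut (Monoid.CoprodI (fun _ : Fin n => H)))
    (hρ : IsArtinRep h ρ) :
    Function.Injective ρ := by
  rw [injective_iff_map_eq_one]
  intro β hβ
  obtain ⟨x, hx⟩ := InfBraidGroup.exists_iterate_shift_eq h hh n (hρ.rep_embed_eq_one hβ)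
  exact BraidGroup.eq_one_of_embed_eq (by omega) hx
end

section
/- Let n ≥ 2 and let B_{n−1} denote the subgroup of the braid group Bₙ generated by σ₂, …, σ_{n−1}. Then every β ∈ Bₙ satisfies at least one of the following: (1) β ∈ B_{n−1}; or (2) β can be written β = α₀ σ₁ α₁ σ₁ α₂ ⋯ σ₁ α_l with l ≥ 1 and α₀, …, α_l ∈ B_{n−1}; or (3) β can be written β = α₀ σ₁⁻¹ α₁ σ₁⁻¹ α₂ ⋯ σ₁⁻¹ α_l with l ≥ 1 and α₀, …, α_l ∈ B_{n−1}. -/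
/-! ### The monoid of positive braids -/

inductive PositiveBraidRel (m : ℕ) : FreeMonoid (Fin m) → FreeMonoid (Fin m) → Prop
  | adj (i j : Fin m) (h : (i : ℕ) + 1 = j) :
      PositiveBraidRel m (.of i * .of j * .of i) (.of j * .of i * .of j)
  | far (i j : Fin m) (h : (i : ℕ) + 2 ≤ j) :
      PositiveBraidRel m (.of i * .of j) (.of j * .of i)

abbrev PositiveBraid (m : ℕ) : Type := PresentedMonoid (PositiveBraidRel m)

namespace PositiveBraid

variable {m : ℕ}

def gen (i : Fin m) : PositiveBraid m := PresentedMonoid.of _ i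

abbrev mk (w : FreeMonoid (Fin m)) : PositiveBraid m := PresentedMonoid.mk _ w

def Adj (i j : Fin m) : Prop := (i : ℕ) + 1 = j ∨ (j : ℕ) + 1 = i

def Far (i j : Fin m) : Prop := (i : ℕ) + 2 ≤ j ∨ (j : ℕ) + 2 ≤ i

theorem Adj.symm {i j : Fin m} (h : Adj i j) : Adj j i := Or.symm h

theorem Far.symm {i j : Fin m} (h : Far i j) : Far j i := Or.symm h

theorem eq_or_adj_or_far (i j : Fin m) : i = j ∨ Adj i j ∨ Far i j := by
  simp only [Adj, Far, Fin.ext_iff]; omega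

theorem gen_braid {i j : Fin m} (h : Adj i j) :
    gen i * (gen j * gen i) = gen j * (gen i * gen j) := by
  rw [← mul_assoc, ← mul_assoc]
  rcases h with h | h
  · exact PresentedMonoid.mk_eq_mk_of_rel (PositiveBraidRel.adj i j h)
  · exact (PresentedMonoid.mk_eq_mk_of_rel (PositiveBraidRel.adj j i h)).symm

theorem gen_braid_mul {i j : Fin m} (h : Adj i j) (w : PositiveBraid m) :
    gen i * (gen j * (gen i * w)) = gen j * (gen i * (gen j * w)) := by
  simpa only [mul_assoc] using congrArg (· * w) (gen_braid h)

theorem gen_comm {i j : Fin m} (h : Far i j) : gen i * gen j = gen j * gen i := by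
  rcases h with h | h
  · exact PresentedMonoid.mk_eq_mk_of_rel (PositiveBraidRel.far i j h)
  · exact (PresentedMonoid.mk_eq_mk_of_rel (PositiveBraidRel.far j i h)).symm

theorem gen_comm_mul {i j : Fin m} (h : Far i j) (w : PositiveBraid m) :
    gen i * (gen j * w) = gen j * (gen i * w) := by
  rw [← mul_assoc, gen_comm h, mul_assoc]

/-- A map on generators satisfying the braid relations extends to positive braids. -/
def liftHom {N : Type*} [Monoid N] (f : Fin m → N)
    (hadj : ∀ i j : Fin m, (i : ℕ) + 1 = j → f i * f j * f i = f j * f i * f j)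
    (hfar : ∀ i j : Fin m, (i : ℕ) + 2 ≤ j → f i * f j = f j * f i) : PositiveBraid m →* N :=
  PresentedMonoid.lift f (by
    rintro _ _ (⟨i, j, h⟩ | ⟨i, j, h⟩)
    · simpa using hadj i j h
    · simpa using hfar i j h)

theorem induction_right {p : PositiveBraid m → Prop} (one : p 1)
    (mul_gen : ∀ x i, p x → p (x * gen i)) (x : PositiveBraid m) : p x := by
  have hx : x ∈ Submonoid.closure (Set.range (PresentedMonoid.of (PositiveBraidRel m))) := by
    rw [PresentedMonoid.closure_range_of]; trivial
  induction hx using Submonoid.closure_induction_right with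
  | one => exact one
  | mul_right x _ y hy ih =>
    obtain ⟨i, rfl⟩ := hy
    exact mul_gen x i ih

/-! ### Length -/

def lengthHom (m : ℕ) : PositiveBraid m →* Multiplicative ℕ :=
  liftHom (fun _ => Multiplicative.ofAdd 1) (fun _ _ _ => rfl) (fun _ _ _ => rfl)

def length (x : PositiveBraid m) : ℕ := (lengthHom m x).toAdd

@[simp] theorem length_one : length (1 : PositiveBraid m) = 0 := by simp [length]

@[simp] theorem length_mul (x y : PositiveBraid m) : length (x * y) = length x + length y := by
  simp [length]

@[simp] theorem length_gen (i : Fin m) : length (gen i) = 1 := rfl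

@[simp] theorem length_mk (w : FreeMonoid (Fin m)) : length (mk w) = w.length := by
  induction w using FreeMonoid.inductionOn' with
  | one => simp [mk]
  | of_mul i w ih =>
    have : mk (FreeMonoid.of i * w) = gen i * mk w := rfl
    rw [this, length_mul, ih, FreeMonoid.length_mul, length_gen, FreeMonoid.length_of]

theorem finite_dvd (D : PositiveBraid m) : Finite {x : PositiveBraid m // x ∣ D} := by
  refine Set.Finite.subset
    ((List.finite_length_le (Fin m) (length D)).image fun l => mk (FreeMonoid.ofList l)) ?_
  rintro x ⟨e, he⟩
  obtain ⟨w, rfl⟩ := PresentedMonoid.surjective_mk x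
  refine ⟨w.toList, ?_, rfl⟩
  have := congrArg length he
  rw [length_mul, length_mk] at this
  change w.length ≤ _
  omega

/-! ### Least common multiples of generators -/

/-- `gen i * u` and `gen j * v` agree because both pass through the least common right multiple
of `gen i` and `gen j`. -/
def Resolves (i j : Fin m) (u v : PositiveBraid m) : Prop :=
  (i = j ∧ u = v) ∨
  (Adj i j ∧ ∃ w, u = gen j * (gen i * w) ∧ v = gen i * (gen j * w)) ∨
  (Far i j ∧ ∃ w, u = gen j * w ∧ v = gen i * w)

theorem Resolves.symm {i j : Fin m} {u v : PositiveBraid m} (h : Resolves i j u v) :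
    Resolves j i v u := by
  rcases h with ⟨h, e⟩ | ⟨h, w, e, e'⟩ | ⟨h, w, e, e'⟩
  · exact .inl ⟨h.symm, e.symm⟩
  · exact .inr (.inl ⟨h.symm, w, e', e⟩)
  · exact .inr (.inr ⟨h.symm, w, e', e⟩)

theorem Resolves.mul_right {i j : Fin m} {u v : PositiveBraid m} (h : Resolves i j u v)
    (z : PositiveBraid m) : Resolves i j (u * z) (v * z) := by
  rcases h with ⟨h, rfl⟩ | ⟨h, w, rfl, rfl⟩ | ⟨h, w, rfl, rfl⟩
  · exact .inl ⟨h, rfl⟩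
  · exact .inr (.inl ⟨h, w * z, by simp only [mul_assoc], by simp only [mul_assoc]⟩)
  · exact .inr (.inr ⟨h, w * z, by simp only [mul_assoc], by simp only [mul_assoc]⟩)

theorem Resolves.eq {i : Fin m} {u v : PositiveBraid m} (h : Resolves i i u v) : u = v := by
  rcases h with ⟨-, e⟩ | ⟨h, -⟩ | ⟨h, -⟩
  · exact e
  · simp [Adj] at h
  · simp [Far] at h

theorem Resolves.of_adj {i j : Fin m} {u v : PositiveBraid m} (h : Resolves i j u v)
    (hij : Adj i j) : ∃ w, u = gen j * (gen i * w) ∧ v = gen i * (gen j * w) := by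
  rcases h with ⟨rfl, -⟩ | ⟨-, h⟩ | ⟨h, -⟩
  · simp [Adj] at hij
  · exact h
  · simp only [Adj, Far] at h hij; omega

theorem Resolves.of_far {i j : Fin m} {u v : PositiveBraid m} (h : Resolves i j u v)
    (hij : Far i j) : ∃ w, u = gen j * w ∧ v = gen i * w := by
  rcases h with ⟨rfl, -⟩ | ⟨h, -⟩ | ⟨-, h⟩
  · simp [Far] at hij
  · simp only [Adj, Far] at h hij; omega
  · exact h

def ResolvesBelow (m N : ℕ) : Prop :=
  ∀ (i j : Fin m) (u v : PositiveBraid m), length u < N → gen i * u = gen j * v → Resolves i j u v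

theorem ResolvesBelow.trans_adj_adj {N : ℕ} (hN : ResolvesBelow m N) {i j k : Fin m}
    {a b : PositiveBraid m} (hik : Adj i k) (hkj : Adj k j) (hlen : length a + 2 ≤ N)
    (h : gen i * (gen k * a) = gen j * (gen k * b)) :
    Resolves i j (gen k * (gen i * a)) (gen k * (gen j * b)) := by
  have hl := congrArg length h
  simp only [length_mul, length_gen] at hl
  have h0 := hN _ _ _ _ (by simp; omega) h
  rcases eq_or_adj_or_far i j with rfl | hij | hij
  · have := (hN _ _ _ _ (by omega) h0.eq).eq
    exact .inl ⟨rfl, by rw [this]⟩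
  · simp only [Adj] at hij hik hkj; omega
  obtain ⟨w₁, e₁, e₂⟩ := h0.of_far hij
  have l₁ := congrArg length e₁
  simp only [length_mul, length_gen] at l₁
  obtain ⟨w₂, rfl, e₃⟩ := (hN _ _ _ _ (by omega) e₁).of_adj hkj
  obtain ⟨w₃, rfl, e₄⟩ := (hN _ _ _ _ (by omega) e₂).of_adj hik.symm
  rw [e₃] at e₄
  simp only [length_mul, length_gen] at hlen hl l₁
  have e₅ := (hN _ _ _ _ (by simp; omega) e₄).eq
  obtain ⟨w₄, rfl, rfl⟩ := (hN _ _ _ _ (by omega) e₅).of_far hij.symm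
  refine .inr (.inr ⟨hij, gen k * (gen j * (gen i * (gen k * w₄))), ?_, ?_⟩)
  · rw [gen_comm_mul hij, gen_braid_mul hik, gen_braid_mul hkj]
  · rw [gen_comm_mul hij.symm, gen_braid_mul hkj.symm, gen_braid_mul hik.symm,
      gen_comm_mul hij.symm]

theorem ResolvesBelow.trans_adj_far {N : ℕ} (hN : ResolvesBelow m N) {i j k : Fin m}
    {a b : PositiveBraid m} (hik : Adj i k) (hkj : Far k j) (hlen : length a + 2 ≤ N)
    (h : gen i * (gen k * a) = gen j * b) :
    Resolves i j (gen k * (gen i * a)) (gen k * b) := by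
  have h0 := hN _ _ _ _ (by simp; omega) h
  rcases eq_or_adj_or_far i j with rfl | hij | hij
  · simp only [Adj, Far] at hik hkj; omega
  · obtain ⟨w₁, e₁, rfl⟩ := h0.of_adj hij
    have l₁ := congrArg length e₁
    simp only [length_mul, length_gen] at l₁
    obtain ⟨w₂, rfl, e₂⟩ := (hN _ _ _ _ (by omega) e₁).of_far hkj
    simp only [length_mul, length_gen] at hlen l₁
    obtain ⟨w₃, rfl, rfl⟩ := (hN _ _ _ _ (by omega) e₂).of_adj hik
    refine .inr (.inl ⟨hij, gen k * (gen i * (gen j * w₃)), ?_, ?_⟩)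
    · rw [gen_braid_mul hij, gen_comm_mul hkj, gen_comm_mul hkj.symm w₃, gen_braid_mul hik.symm]
    · rw [gen_comm_mul hkj.symm, gen_braid_mul hik.symm, gen_braid_mul hij,
        gen_comm_mul hkj]
  · obtain ⟨w₁, e₁, rfl⟩ := h0.of_far hij
    obtain ⟨w₂, rfl, rfl⟩ := (hN _ _ _ _ (by omega) e₁).of_far hkj
    refine .inr (.inr ⟨hij, gen k * (gen i * w₂), ?_, ?_⟩)
    · rw [gen_comm_mul hij, gen_comm_mul hkj]
    · rw [gen_braid_mul hik]

theorem ResolvesBelow.trans_far_far {N : ℕ} (hN : ResolvesBelow m N) {i j k : Fin m}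
    {a b : PositiveBraid m} (hik : Far i k) (hkj : Far k j) (hlen : length a + 1 ≤ N)
    (h : gen i * a = gen j * b) : Resolves i j (gen k * a) (gen k * b) := by
  have h0 := hN _ _ _ _ (by omega) h
  rcases eq_or_adj_or_far i j with rfl | hij | hij
  · exact .inl ⟨rfl, by rw [h0.eq]⟩
  · obtain ⟨w, rfl, rfl⟩ := h0.of_adj hij
    refine .inr (.inl ⟨hij, gen k * w, ?_, ?_⟩)
    · rw [gen_comm_mul hkj, gen_comm_mul hik.symm]
    · rw [gen_comm_mul hik.symm, gen_comm_mul hkj]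
  · obtain ⟨w, rfl, rfl⟩ := h0.of_far hij
    exact .inr (.inr ⟨hij, gen k * w, gen_comm_mul hkj _, gen_comm_mul hik.symm _⟩)

theorem ResolvesBelow.trans {N : ℕ} (hN : ResolvesBelow m N) {i j k : Fin m}
    {u t v : PositiveBraid m} (hlen : length t ≤ N) (h₁ : Resolves i k u t)
    (h₂ : Resolves k j t v) : Resolves i j u v := by
  rcases h₁ with ⟨rfl, rfl⟩ | ⟨hik, a, rfl, rfl⟩ | ⟨hik, a, rfl, rfl⟩
  · exact h₂
  · rcases h₂ with ⟨rfl, rfl⟩ | ⟨hkj, b, e, rfl⟩ | ⟨hkj, b, e, rfl⟩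
    · exact .inr (.inl ⟨hik, a, rfl, rfl⟩)
    · exact hN.trans_adj_adj hik hkj (by simp at hlen; omega) e
    · exact hN.trans_adj_far hik hkj (by simp at hlen; omega) e
  · rcases h₂ with ⟨rfl, rfl⟩ | ⟨hkj, b, e, rfl⟩ | ⟨hkj, b, e, rfl⟩
    · exact .inr (.inr ⟨hik, a, rfl, rfl⟩)
    · refine (hN.trans_adj_far hkj.symm hik.symm ?_ e.symm).symm
      have := congrArg length e
      simp at hlen this; omega
    · exact hN.trans_far_far hik hkj (by simp at hlen; omega) e

theorem resolves_of_rel {N : ℕ} (hN : ResolvesBelow m N) {a b : FreeMonoid (Fin m)}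
    (hab : ConGen.Rel (PositiveBraidRel m) a b) (hlen : a.length ≤ N + 1) :
    ∀ i u j v, a = .of i * u → b = .of j * v → Resolves i j (mk u) (mk v) := by
  have length_eq {a b : FreeMonoid (Fin m)} (h : ConGen.Rel (PositiveBraidRel m) a b) :
      a.length = b.length :=
    (length_mk a).symm.trans
      ((congrArg length (PresentedMonoid.mk_eq_mk_iff.2 h)).trans (length_mk b))
  have cons_inj {i j : Fin m} {u v : FreeMonoid (Fin m)}
      (h : FreeMonoid.of i * u = FreeMonoid.of j * v) : i = j ∧ u = v :=
    List.cons.inj (congrArg FreeMonoid.toList h)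
  induction hab with
  | of x y h =>
    rintro i u j v h₁ h₂
    rcases h with ⟨p, q, h⟩ | ⟨p, q, h⟩
    · rw [mul_assoc] at h₁ h₂
      obtain ⟨rfl, rfl⟩ := cons_inj h₁
      obtain ⟨rfl, rfl⟩ := cons_inj h₂
      refine .inr (.inl ⟨.inl h, 1, ?_, ?_⟩) <;> rw [mul_one] <;> rfl
    · obtain ⟨rfl, rfl⟩ := cons_inj h₁
      obtain ⟨rfl, rfl⟩ := cons_inj h₂
      refine .inr (.inr ⟨.inl h, 1, ?_, ?_⟩) <;> rw [mul_one] <;> rfl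
  | refl x =>
    rintro i u j v rfl h
    obtain ⟨rfl, rfl⟩ := cons_inj h
    exact .inl ⟨rfl, rfl⟩
  | symm h ih =>
    exact fun i u j v h₁ h₂ => (ih (by rw [length_eq h]; exact hlen) j v i u h₂ h₁).symm
  | @trans x y z hxy hyz ih₁ ih₂ =>
    rintro i u j v rfl rfl
    have hl := length_eq hxy
    cases y using FreeMonoid.casesOn with
    | one => simp at hl
    | of_mul k t =>
      refine hN.trans ?_ (ih₁ hlen i u k t rfl rfl) (ih₂ (by omega) k t j v rfl rfl)
      simp at hl hlen ⊢; omega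
  | @mul w x y z hwx hyz ih₁ ih₂ =>
    intro i u j v h₁ h₂
    have hl := length_eq hwx
    cases w using FreeMonoid.casesOn with
    | one =>
      obtain rfl : x = 1 := FreeMonoid.length_eq_zero.1 (by simpa using hl.symm)
      rw [one_mul] at h₁ h₂ hlen
      exact ih₂ hlen i u j v h₁ h₂
    | of_mul p w' =>
      cases x using FreeMonoid.casesOn with
      | one => simp at hl
      | of_mul q x' =>
        rw [mul_assoc] at h₁ h₂
        obtain ⟨rfl, rfl⟩ := cons_inj h₁
        obtain ⟨rfl, rfl⟩ := cons_inj h₂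
        have e : mk y = mk z := PresentedMonoid.mk_eq_mk_iff.2 hyz
        have e₁ : mk (w' * y) = mk w' * mk y := map_mul _ _ _
        have e₂ : mk (x' * z) = mk x' * mk y := by rw [e]; exact map_mul _ _ _
        rw [e₁, e₂]
        exact (ih₁ (by simp at hlen ⊢; omega) p w' q x' rfl rfl).mul_right _

theorem resolvesBelow (m N : ℕ) : ResolvesBelow m N := by
  induction N with
  | zero => exact fun _ _ _ _ h => absurd h (Nat.not_lt_zero _)
  | succ N ih =>
    intro i j u v hlen h
    obtain ⟨u, rfl⟩ := PresentedMonoid.surjective_mk u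
    obtain ⟨v, rfl⟩ := PresentedMonoid.surjective_mk v
    have hr : ConGen.Rel (PositiveBraidRel m) (.of i * u) (.of j * v) :=
      PresentedMonoid.mk_eq_mk_iff.1 h
    refine resolves_of_rel ih hr ?_ i u j v rfl rfl
    rw [length_mk] at hlen
    simp; omega

theorem resolves {i j : Fin m} {u v : PositiveBraid m} (h : gen i * u = gen j * v) :
    Resolves i j u v :=
  resolvesBelow m (length u + 1) i j u v (Nat.lt_succ_self _) h

theorem gen_mul_left_cancel {i : Fin m} {u v : PositiveBraid m} (h : gen i * u = gen i * v) :
    u = v :=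
  (resolves h).eq

theorem mul_left_cancel_of_eq (x : PositiveBraid m) :
    ∀ {u v : PositiveBraid m}, x * u = x * v → u = v := by
  induction x using induction_right with
  | one => simp
  | mul_gen x i ih =>
    intro u v h
    rw [mul_assoc, mul_assoc] at h
    exact gen_mul_left_cancel (ih h)

/-! ### Reversal -/

def reverseHom (m : ℕ) : PositiveBraid m →* (PositiveBraid m)ᵐᵒᵖ :=
  liftHom (fun i => .op (gen i))
    (fun _ _ h => MulOpposite.unop_injective (gen_braid (.inl h)))
    (fun _ _ h => MulOpposite.unop_injective (gen_comm (.inr h)))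

def reverse (x : PositiveBraid m) : PositiveBraid m := (reverseHom m x).unop

@[simp] theorem reverse_one : reverse (1 : PositiveBraid m) = 1 := by simp [reverse]

@[simp] theorem reverse_mul (x y : PositiveBraid m) :
    reverse (x * y) = reverse y * reverse x := by
  simp [reverse]

@[simp] theorem reverse_gen (i : Fin m) : reverse (gen i) = gen i := rfl

@[simp] theorem reverse_reverse (x : PositiveBraid m) : reverse (reverse x) = x := by
  induction x using induction_right with
  | one => simp
  | mul_gen x i ih => simp [ih]

theorem resolves_reverse {i j : Fin m} {u v : PositiveBraid m} (h : u * gen i = v * gen j) :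
    Resolves i j (reverse u) (reverse v) :=
  resolves (by simpa using congrArg reverse h)

theorem mul_gen_right_cancel {i : Fin m} {u v : PositiveBraid m} (h : u * gen i = v * gen i) :
    u = v := by
  simpa using congrArg reverse (resolves_reverse h).eq

theorem exists_of_mul_gen_eq_adj {i j : Fin m} {u v : PositiveBraid m} (hij : Adj i j)
    (h : u * gen i = v * gen j) : ∃ w, u = w * gen i * gen j ∧ v = w * gen j * gen i := by
  obtain ⟨w, h₁, h₂⟩ := (resolves_reverse h).of_adj hij
  exact ⟨reverse w, by simpa using congrArg reverse h₁, by simpa using congrArg reverse h₂⟩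

theorem exists_of_mul_gen_eq_far {i j : Fin m} {u v : PositiveBraid m} (hij : Far i j)
    (h : u * gen i = v * gen j) : ∃ w, u = w * gen j ∧ v = w * gen i := by
  obtain ⟨w, h₁, h₂⟩ := (resolves_reverse h).of_far hij
  exact ⟨reverse w, by simpa using congrArg reverse h₁, by simpa using congrArg reverse h₂⟩

/-! ### A central common multiple of the generators -/

/-- The generator of index `i`, or `1` when `i` is out of range. -/
def genNat (m i : ℕ) : PositiveBraid m := if h : i < m then gen ⟨i, h⟩ else 1

def genProd (m : ℕ) : ℕ → PositiveBraid m
  | 0 => 1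
  | k + 1 => genProd m k * genNat m k

theorem genNat_comm {i j : ℕ} (h : i + 2 ≤ j) :
    genNat m i * genNat m j = genNat m j * genNat m i := by
  unfold genNat
  split_ifs
  · exact gen_comm (.inl h)
  all_goals simp

theorem genNat_braid {i : ℕ} (h : i + 1 < m) :
    genNat m i * genNat m (i + 1) * genNat m i =
      genNat m (i + 1) * genNat m i * genNat m (i + 1) := by
  simp only [genNat, h, (by omega : i < m), dif_pos, mul_assoc]
  exact gen_braid (.inl rfl)

theorem genProd_commute {k j : ℕ} (h : k < j) : Commute (genProd m k) (genNat m j) := by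
  induction k with
  | zero => exact Commute.one_left _
  | succ k ih => exact (ih (by omega)).mul_left (genNat_comm (by omega))

theorem genProd_semiconj {k i : ℕ} (hi : i + 1 < k) (hk : k ≤ m) :
    SemiconjBy (genProd m k) (genNat m i) (genNat m (i + 1)) := by
  induction k with
  | zero => omega
  | succ k ih =>
    rcases Nat.lt_or_ge (i + 1) k with h | h
    · exact (ih h (by omega)).mul_left (genNat_comm (by omega)).symm
    · obtain rfl : k = i + 1 := by omega
      have hc := (genProd_commute (m := m) (k := i) (j := i + 1) (by omega)).eq
      simp only [SemiconjBy, genProd]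
      calc genProd m i * genNat m i * genNat m (i + 1) * genNat m i
          = genProd m i * (genNat m i * genNat m (i + 1) * genNat m i) := by
            simp only [mul_assoc]
        _ = genProd m i * genNat m (i + 1) * (genNat m i * genNat m (i + 1)) := by
            rw [genNat_braid (by omega)]; simp only [mul_assoc]
        _ = _ := by rw [hc]; simp only [mul_assoc]

theorem genNat_zero_mul_genProd {k j : ℕ} (hj : j ≤ k) (hk : k + 1 ≤ m) :
    genNat m 0 * genProd m (k + 1) * genProd m j = genProd m (j + 1) * genProd m (k + 1) := by
  induction j with
  | zero => simp [genProd]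
  | succ j ih =>
    have hs := (genProd_semiconj (m := m) (k := k + 1) (i := j) (by omega) hk).eq
    rw [show genProd m (j + 1) = genProd m j * genNat m j from rfl, ← mul_assoc,
      ih (by omega), mul_assoc, hs, ← mul_assoc]
    rfl

theorem genProd_sq_semiconj (k : ℕ) :
    SemiconjBy (genProd (k + 1) (k + 1) ^ 2) (genNat (k + 1) k) (genNat (k + 1) 0) := by
  have h := genNat_zero_mul_genProd (m := k + 1) (k := k) le_rfl le_rfl
  calc genProd (k + 1) (k + 1) ^ 2 * genNat (k + 1) k
      = genNat (k + 1) 0 * genProd (k + 1) (k + 1) * genProd (k + 1) k * genNat (k + 1) k := by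
        rw [h, sq]
    _ = _ := by rw [sq]; simp only [mul_assoc]; rfl

theorem genProd_pow_semiconj {k i j : ℕ} (h : i + j ≤ k) :
    SemiconjBy (genProd (k + 1) (k + 1) ^ j) (genNat (k + 1) i) (genNat (k + 1) (i + j)) := by
  induction j with
  | zero => simp
  | succ j ih =>
    rw [pow_succ']
    exact (genProd_semiconj (i := i + j) (by omega) le_rfl).mul_left (ih (by omega))

theorem genProd_eq_genNat_zero_mul (m k : ℕ) : ∃ y, genProd m (k + 1) = genNat m 0 * y := by
  induction k with
  | zero => exact ⟨1, by simp [genProd]⟩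
  | succ k ih =>
    obtain ⟨y, hy⟩ := ih
    exact ⟨y * genNat m (k + 1), by rw [genProd, hy, mul_assoc]⟩

theorem exists_central_multiple (m : ℕ) :
    ∃ Z : PositiveBraid m, (∀ x, Commute Z x) ∧ ∀ i, gen i ∣ Z := by
  obtain _ | k := m
  · exact ⟨1, fun x => Commute.one_left x, fun i => i.elim0⟩
  have hgen (i : Fin (k + 1)) : gen i = genNat (k + 1) i := by
    rw [genNat, dif_pos i.2]
  refine ⟨genProd (k + 1) (k + 1) ^ (k + 2), fun x => ?_, fun i => ?_⟩
  · induction x using induction_right with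
    | one => exact Commute.one_right _
    | mul_gen x i ih =>
      refine ih.mul_right ?_
      have hi : (i : ℕ) ≤ k := by omega
      have h₁ := genProd_pow_semiconj (k := k) (i := i) (j := k - i) (by omega)
      have h₂ := genProd_pow_semiconj (k := k) (i := 0) (j := i) (by omega)
      rw [Nat.add_sub_cancel' hi] at h₁
      rw [Nat.zero_add] at h₂
      have := (h₂.mul_left (genProd_sq_semiconj k)).mul_left h₁
      rw [← pow_add, ← pow_add, (by omega : (i : ℕ) + 2 + (k - i) = k + 2)] at this
      rw [hgen]
      exact this
  · obtain ⟨y, hy⟩ := genProd_eq_genNat_zero_mul (k + 1) k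
    have h := genProd_pow_semiconj (k := k) (i := 0) (j := i) (by omega)
    rw [Nat.zero_add] at h
    refine ⟨genProd (k + 1) (k + 1) ^ (i : ℕ) * y * genProd (k + 1) (k + 1) ^ (k + 1 - i), ?_⟩
    rw [hgen, (by omega : k + 2 = i + 1 + (k + 1 - i)), pow_add, pow_succ, ← mul_assoc,
      ← mul_assoc, ← h.eq]
    nth_rw 2 [hy]
    simp only [mul_assoc]

end PositiveBraid

/-! ### Dynnikov coordinates -/

noncomputable section

def coordA (x₁ y₁ x₂ : ℝ) : ℝ := x₁ * (1 + y₁) + y₁ * x₂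

def coordN (x₁ y₁ x₂ y₂ : ℝ) : ℝ := y₁ * x₂ + x₁ * (1 + y₁) * (1 + y₂)

def coordB (x₁ y₁ x₂ y₂ : ℝ) : ℝ := y₁ * y₂ * x₂ / coordN x₁ y₁ x₂ y₂

def coordC (x₁ x₂ y₂ : ℝ) : ℝ := x₁ * x₂ * y₂ / (x₂ + x₁ * (1 + y₂))

def coordD (x₁ y₁ x₂ y₂ : ℝ) : ℝ := coordN x₁ y₁ x₂ y₂ / x₂

theorem coordB_mul_coordD {x₁ y₁ x₂ y₂ : ℝ} (h₁ : 0 < x₁) (h₂ : 0 < y₁) (h₃ : 0 < x₂)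
    (h₄ : 0 < y₂) : coordB x₁ y₁ x₂ y₂ * coordD x₁ y₁ x₂ y₂ = y₁ * y₂ := by
  simp only [coordB, coordD, coordN]
  field_simp

abbrev PosPair : Type := {p : ℝ × ℝ // 0 < p.1 ∧ 0 < p.2}

/-- Dynnikov's action of one half twist on the coordinates of two neighbouring strands, in its
rational form. -/
def halfTwist (a b : PosPair) : PosPair × PosPair :=
  (⟨(coordA a.1.1 a.1.2 b.1.1, coordB a.1.1 a.1.2 b.1.1 b.1.2), by
      obtain ⟨⟨x₁, y₁⟩, h₁, h₂⟩ := a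
      obtain ⟨⟨x₂, y₂⟩, h₃, h₄⟩ := b
      simp only [coordA, coordB, coordN] at *
      constructor <;> positivity⟩,
    ⟨(coordC a.1.1 b.1.1 b.1.2, coordD a.1.1 a.1.2 b.1.1 b.1.2), by
      obtain ⟨⟨x₁, y₁⟩, h₁, h₂⟩ := a
      obtain ⟨⟨x₂, y₂⟩, h₃, h₄⟩ := b
      simp only [coordC, coordD, coordN] at *
      constructor <;> positivity⟩)

def applyAt (i : ℕ) (v : ℕ → PosPair) : ℕ → PosPair :=
  Function.update (Function.update v i (halfTwist (v i) (v (i + 1))).1) (i + 1)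
    (halfTwist (v i) (v (i + 1))).2

theorem applyAt_self (i : ℕ) (v : ℕ → PosPair) :
    applyAt i v i = (halfTwist (v i) (v (i + 1))).1 := by
  simp [applyAt]

theorem applyAt_succ (i : ℕ) (v : ℕ → PosPair) :
    applyAt i v (i + 1) = (halfTwist (v i) (v (i + 1))).2 := by
  simp [applyAt]

theorem applyAt_of_ne {i j : ℕ} (v : ℕ → PosPair) (h : j ≠ i) (h' : j ≠ i + 1) :
    applyAt i v j = v j := by
  simp [applyAt, h, h']

theorem applyAt_comm {i j : ℕ} (h : i + 2 ≤ j) (v : ℕ → PosPair) :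
    applyAt i (applyAt j v) = applyAt j (applyAt i v) := by
  have e₁ : applyAt j v i = v i := applyAt_of_ne _ (by omega) (by omega)
  have e₂ : applyAt j v (i + 1) = v (i + 1) := applyAt_of_ne _ (by omega) (by omega)
  have e₃ : applyAt i v j = v j := applyAt_of_ne _ (by omega) (by omega)
  have e₄ : applyAt i v (j + 1) = v (j + 1) := applyAt_of_ne _ (by omega) (by omega)
  funext k
  by_cases h₁ : k = i
  · subst h₁
    have h₃ : k ≠ j := by omega
    have h₄ : k ≠ j + 1 := by omega
    rw [applyAt_of_ne (applyAt k v) h₃ h₄, applyAt_self, applyAt_self, e₁, e₂]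
  by_cases h₂ : k = i + 1
  · subst h₂
    have h₃ : i + 1 ≠ j := by omega
    have h₄ : i + 1 ≠ j + 1 := by omega
    rw [applyAt_of_ne (applyAt i v) h₃ h₄, applyAt_succ, applyAt_succ, e₁, e₂]
  rw [applyAt_of_ne _ h₁ h₂]
  by_cases h₃ : k = j
  · subst h₃
    rw [applyAt_self, applyAt_self, e₃, e₄]
  by_cases h₄ : k = j + 1
  · subst h₄
    rw [applyAt_succ, applyAt_succ, e₃, e₄]
  rw [applyAt_of_ne _ h₃ h₄, applyAt_of_ne _ h₃ h₄, applyAt_of_ne _ h₁ h₂]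

def twistLeft (v : PosPair × PosPair × PosPair) : PosPair × PosPair × PosPair :=
  ((halfTwist v.1 v.2.1).1, (halfTwist v.1 v.2.1).2, v.2.2)

def twistRight (v : PosPair × PosPair × PosPair) : PosPair × PosPair × PosPair :=
  (v.1, (halfTwist v.2.1 v.2.2).1, (halfTwist v.2.1 v.2.2).2)

theorem twistLeft_prod (v : PosPair × PosPair × PosPair) :
    (twistLeft v).1.1.2 * (twistLeft v).2.1.1.2 * (twistLeft v).2.2.1.2 =
      v.1.1.2 * v.2.1.1.2 * v.2.2.1.2 := by
  simp only [twistLeft, halfTwist]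
  rw [coordB_mul_coordD v.1.2.1 v.1.2.2 v.2.1.2.1 v.2.1.2.2]

theorem twistRight_prod (v : PosPair × PosPair × PosPair) :
    (twistRight v).1.1.2 * (twistRight v).2.1.1.2 * (twistRight v).2.2.1.2 =
      v.1.1.2 * v.2.1.1.2 * v.2.2.1.2 := by
  simp only [twistRight, halfTwist]
  rw [mul_assoc, coordB_mul_coordD v.2.1.2.1 v.2.1.2.2 v.2.2.2.1 v.2.2.2.2, mul_assoc]

theorem coordC_coordA_coordD (x₁ y₁ x₂ y₂ x₃ y₃ : ℝ) (h₁ : 0 < x₁) (h₂ : 0 < y₁) (h₃ : 0 < x₂)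
    (h₄ : 0 < y₂) (h₅ : 0 < x₃) (h₆ : 0 < y₃) :
    coordC (coordA x₁ y₁ x₂) (coordA (coordC x₁ x₂ y₂) (coordD x₁ y₁ x₂ y₂) x₃)
        (coordB (coordC x₁ x₂ y₂) (coordD x₁ y₁ x₂ y₂) x₃ y₃) =
      coordA (coordC x₁ (coordA x₂ y₂ x₃) (coordB x₂ y₂ x₃ y₃))
        (coordD x₁ y₁ (coordA x₂ y₂ x₃) (coordB x₂ y₂ x₃ y₃)) (coordC x₂ x₃ y₃) := by
  obtain ⟨N, hN⟩ : ∃ N, N = coordN x₁ y₁ x₂ y₂ := ⟨_, rfl⟩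
  obtain ⟨K, hK⟩ : ∃ K, K = coordN x₂ y₂ x₃ y₃ := ⟨_, rfl⟩
  have hN0 : 0 < N := by rw [hN, coordN]; positivity
  have hK0 : 0 < K := by rw [hK, coordN]; positivity
  have e₁ : coordA (coordC x₁ x₂ y₂) (coordD x₁ y₁ x₂ y₂) x₃
      = x₁ * y₂ * (1 + y₁) + N / x₂ * x₃ := by
    simp only [hN, coordA, coordC, coordD, coordN]; field_simp; ring
  have e₂ : coordB (coordC x₁ x₂ y₂) (coordD x₁ y₁ x₂ y₂) x₃ y₃
      = N * y₃ * x₃ / (N * x₃ + x₁ * x₂ * y₂ * (1 + y₁) * (1 + y₃)) := by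
    have : coordN (coordC x₁ x₂ y₂) (coordD x₁ y₁ x₂ y₂) x₃ y₃ =
        (N * x₃ + x₁ * x₂ * y₂ * (1 + y₁) * (1 + y₃)) / x₂ := by
      simp only [hN, coordC, coordD, coordN]; field_simp; ring
    rw [coordB, this, coordD, ← hN]; field_simp
  have e₃ : coordD x₁ y₁ (coordA x₂ y₂ x₃) (coordB x₂ y₂ x₃ y₃)
      = y₁ + x₁ * (1 + y₁) * (1 + y₃) / K := by
    simp only [hK, coordA, coordB, coordD, coordN]; field_simp; ring
  have e₄ : coordC x₁ (coordA x₂ y₂ x₃) (coordB x₂ y₂ x₃ y₃)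
      = x₁ * y₂ * y₃ * x₃ / (K + x₁ * (1 + y₃)) := by
    simp only [hK, coordA, coordB, coordC, coordN]; field_simp; ring
  rw [e₁, e₂, e₃, e₄]
  simp only [coordA, coordC]
  field_simp
  rw [hN, hK]
  simp only [coordN]
  ring

set_option maxHeartbeats 4000000 in
theorem twist_braid_fst_fst (v : PosPair × PosPair × PosPair) :
    (twistLeft (twistRight (twistLeft v))).1.1.1 =
      (twistRight (twistLeft (twistRight v))).1.1.1 := by
  obtain ⟨⟨⟨x₁, y₁⟩, h₁, h₂⟩, ⟨⟨x₂, y₂⟩, h₃, h₄⟩, ⟨⟨x₃, y₃⟩, h₅, h₆⟩⟩ := v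
  simp only at h₁ h₂ h₃ h₄ h₅ h₆
  simp only [twistLeft, twistRight, halfTwist, coordA, coordB, coordC, coordD, coordN]
  field_simp
  ring

set_option maxHeartbeats 4000000 in
theorem twist_braid_fst_snd (v : PosPair × PosPair × PosPair) :
    (twistLeft (twistRight (twistLeft v))).1.1.2 =
      (twistRight (twistLeft (twistRight v))).1.1.2 := by
  obtain ⟨⟨⟨x₁, y₁⟩, h₁, h₂⟩, ⟨⟨x₂, y₂⟩, h₃, h₄⟩, ⟨⟨x₃, y₃⟩, h₅, h₆⟩⟩ := v
  simp only at h₁ h₂ h₃ h₄ h₅ h₆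
  simp only [twistLeft, twistRight, halfTwist, coordA, coordB, coordC, coordD, coordN]
  field_simp
  ring

set_option maxHeartbeats 4000000 in
theorem twist_braid_trd_fst (v : PosPair × PosPair × PosPair) :
    (twistLeft (twistRight (twistLeft v))).2.2.1.1 =
      (twistRight (twistLeft (twistRight v))).2.2.1.1 := by
  obtain ⟨⟨⟨x₁, y₁⟩, h₁, h₂⟩, ⟨⟨x₂, y₂⟩, h₃, h₄⟩, ⟨⟨x₃, y₃⟩, h₅, h₆⟩⟩ := v
  simp only at h₁ h₂ h₃ h₄ h₅ h₆
  simp only [twistLeft, twistRight, halfTwist, coordA, coordB, coordC, coordD, coordN]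
  field_simp
  ring

set_option maxHeartbeats 4000000 in
theorem twist_braid_trd_snd (v : PosPair × PosPair × PosPair) :
    (twistLeft (twistRight (twistLeft v))).2.2.1.2 =
      (twistRight (twistLeft (twistRight v))).2.2.1.2 := by
  obtain ⟨⟨⟨x₁, y₁⟩, h₁, h₂⟩, ⟨⟨x₂, y₂⟩, h₃, h₄⟩, ⟨⟨x₃, y₃⟩, h₅, h₆⟩⟩ := v
  simp only at h₁ h₂ h₃ h₄ h₅ h₆
  simp only [twistLeft, twistRight, halfTwist, coordA, coordB, coordC, coordD, coordN]
  field_simp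
  ring

theorem twist_braid (v : PosPair × PosPair × PosPair) :
    twistLeft (twistRight (twistLeft v)) = twistRight (twistLeft (twistRight v)) := by
  refine Prod.ext (Subtype.ext (Prod.ext (twist_braid_fst_fst v) (twist_braid_fst_snd v)))
    (Prod.ext (Subtype.ext (Prod.ext ?_ ?_))
      (Subtype.ext (Prod.ext (twist_braid_trd_fst v) (twist_braid_trd_snd v))))
  · exact coordC_coordA_coordD _ _ _ _ _ _ v.1.2.1 v.1.2.2 v.2.1.2.1 v.2.1.2.2 v.2.2.2.1 v.2.2.2.2
  · have h := (twistLeft_prod (twistRight (twistLeft v))).trans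
      ((twistRight_prod (twistLeft v)).trans (twistLeft_prod v))
    have h' := (twistRight_prod (twistLeft (twistRight v))).trans
      ((twistLeft_prod (twistRight v)).trans (twistRight_prod v))
    rw [← h', twist_braid_fst_snd, twist_braid_trd_snd] at h
    exact mul_left_cancel₀ (twistRight (twistLeft (twistRight v))).1.2.2.ne'
      (mul_right_cancel₀ (twistRight (twistLeft (twistRight v))).2.2.2.2.ne' h)

def triple (i : ℕ) (v : ℕ → PosPair) : PosPair × PosPair × PosPair :=
  (v i, v (i + 1), v (i + 1 + 1))

theorem triple_applyAt (i : ℕ) (v : ℕ → PosPair) :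
    triple i (applyAt i v) = twistLeft (triple i v) := by
  simp only [triple, twistLeft, applyAt_self, applyAt_succ,
    applyAt_of_ne (i := i) (j := i + 1 + 1) v (by omega) (by omega)]

theorem triple_applyAt_succ (i : ℕ) (v : ℕ → PosPair) :
    triple i (applyAt (i + 1) v) = twistRight (triple i v) := by
  simp only [triple, twistRight, applyAt_self, applyAt_succ,
    applyAt_of_ne (i := i + 1) (j := i) v (by omega) (by omega)]

theorem applyAt_braid (i : ℕ) (v : ℕ → PosPair) :
    applyAt i (applyAt (i + 1) (applyAt i v)) =
      applyAt (i + 1) (applyAt i (applyAt (i + 1) v)) := by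
  have h : triple i (applyAt i (applyAt (i + 1) (applyAt i v))) =
      triple i (applyAt (i + 1) (applyAt i (applyAt (i + 1) v))) := by
    simp only [triple_applyAt, triple_applyAt_succ, twist_braid]
  funext k
  by_cases h₁ : k = i
  · subst h₁; exact congrArg Prod.fst h
  by_cases h₂ : k = i + 1
  · subst h₂; exact congrArg (fun t => t.2.1) h
  by_cases h₃ : k = i + 1 + 1
  · subst h₃; exact congrArg (fun t => t.2.2) h
  simp only [applyAt_of_ne _ h₁ h₂, applyAt_of_ne _ h₂ h₃]

def actionHom (m : ℕ) : PositiveBraid m →* (Function.End (ℕ → PosPair))ᵐᵒᵖ :=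
  PositiveBraid.liftHom (fun i => .op (applyAt i))
    (fun i j h => MulOpposite.unop_injective (funext fun v => by
      rw [← h]; exact applyAt_braid i v))
    (fun i j h => MulOpposite.unop_injective (funext fun v => (applyAt_comm h v).symm))

namespace PositiveBraid

variable {m : ℕ}

/-- The coordinates of a positive braid, acting on the right on a fixed base point. -/
def coords (x : PositiveBraid m) : ℕ → PosPair :=
  (actionHom m x).unop fun _ => ⟨(1, 1), one_pos, one_pos⟩

theorem coords_mul_gen (x : PositiveBraid m) (i : Fin m) :
    coords (x * gen i) = applyAt i (coords x) := by
  rw [coords, map_mul]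
  rfl

/-- A quantity increased by `gen k` and preserved by the generators of larger index. -/
def potential (k : ℕ) (x : PositiveBraid m) : ℝ := (coords x k).1.1

theorem potential_mul_gen_of_lt {k : ℕ} (x : PositiveBraid m) {i : Fin m} (h : k < i) :
    potential k (x * gen i) = potential k x := by
  rw [potential, coords_mul_gen, applyAt_of_ne _ (by omega) (by omega), potential]

theorem potential_lt_mul_gen (x : PositiveBraid m) (i : Fin m) :
    potential i x < potential i (x * gen i) := by
  rw [potential, potential, coords_mul_gen, applyAt_self]
  simp only [halfTwist, coordA]
  have h₁ := (coords x i).2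
  have h₂ := (coords x (i + 1)).2
  nlinarith [mul_pos h₁.1 h₁.2, mul_pos h₁.2 h₂.1]

end PositiveBraid

end

/-! ### Confluent relations -/

section Confluence

open Relation

variable {α : Type*} {R E : α → α → Prop}

/-- `a` and `b` are `E`-equivalent or one lies below the other for `R`. -/
def ComparableMod (E R : α → α → Prop) (a b : α) : Prop :=
  E a b ∨ TransGen R a b ∨ TransGen R b a

theorem ComparableMod.symm (hE : Equivalence E) {a b : α} (h : ComparableMod E R a b) :
    ComparableMod E R b a := by
  rcases h with h | h | h
  · exact .inl (hE.symm h)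
  · exact .inr (.inr h)
  · exact .inr (.inl h)

theorem ComparableMod.of_swap {a b : α} (h : ComparableMod E (Function.swap R) a b) :
    ComparableMod E R a b := by
  rcases h with h | h | h
  · exact .inl h
  · exact .inr (.inr (transGen_swap.1 h))
  · exact .inr (.inl (transGen_swap.1 h))

theorem transGen_of_transGen_of_equiv (hRE : ∀ ⦃a b c⦄, R a b → E b c → R a c) {a b c : α}
    (h : TransGen R a b) (h' : E b c) : TransGen R a c := by
  obtain ⟨d, had, hdb⟩ := TransGen.tail'_iff.1 h
  exact TransGen.tail' had (hRE hdb h')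

theorem transGen_of_equiv_of_transGen (hER : ∀ ⦃a b c⦄, E a b → R b c → R a c) {a b c : α}
    (h : E a b) (h' : TransGen R b c) : TransGen R a c := by
  obtain ⟨d, hbd, hdc⟩ := TransGen.head'_iff.1 h'
  exact TransGen.head' (hER h hbd) hdc

theorem comparableMod_of_transGen_of_transGen (hE : Equivalence E)
    (hRE : ∀ ⦃a b c⦄, R a b → E b c → R a c) (hwf : WellFounded R)
    (hloc : ∀ ⦃a b c⦄, R a c → R b c → ComparableMod E R a b) {a b c : α}
    (h₁ : TransGen R a c) (h₂ : TransGen R b c) : ComparableMod E R a b := by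
  induction c using hwf.induction generalizing a b with
  | _ c ih =>
    have key {a b a' b' : α} (hb' : R b' c) (ha : ReflTransGen R a a')
        (hb : ReflTransGen R b b') (h : E a' b' ∨ TransGen R a' b') : ComparableMod E R a b := by
      have hab' : E a b' ∨ TransGen R a b' := by
        rcases reflTransGen_iff_eq_or_transGen.1 ha with rfl | ha
        · exact h
        · exact .inr (h.elim (transGen_of_transGen_of_equiv hRE ha) ha.trans)
      rcases reflTransGen_iff_eq_or_transGen.1 hb with rfl | hb
      · exact hab'.elim .inl (fun h => .inr (.inl h))
      · rcases hab' with h | h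
        · exact .inr (.inr (transGen_of_transGen_of_equiv hRE hb (hE.symm h)))
        · exact ih b' hb' h hb
    obtain ⟨a', ha, ha'⟩ := TransGen.tail'_iff.1 h₁
    obtain ⟨b', hb, hb'⟩ := TransGen.tail'_iff.1 h₂
    rcases hloc ha' hb' with h | h | h
    · exact key hb' ha hb (.inl h)
    · exact key hb' ha hb (.inr h)
    · exact (key ha' hb ha (.inr h)).symm hE

theorem ComparableMod.trans (hE : Equivalence E) (hER : ∀ ⦃a b c⦄, E a b → R b c → R a c)
    (hRE : ∀ ⦃a b c⦄, R a b → E b c → R a c) (hwf : WellFounded R)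
    (hwf' : WellFounded (Function.swap R))
    (hpeak : ∀ ⦃a b c⦄, R a c → R b c → ComparableMod E R a b)
    (hvalley : ∀ ⦃a b c⦄, R c a → R c b → ComparableMod E R a b) {a b c : α}
    (h₁ : ComparableMod E R a b) (h₂ : ComparableMod E R b c) : ComparableMod E R a c := by
  rcases h₁ with h₁ | h₁ | h₁ <;> rcases h₂ with h₂ | h₂ | h₂
  · exact .inl (hE.trans h₁ h₂)
  · exact .inr (.inl (transGen_of_equiv_of_transGen hER h₁ h₂))
  · exact .inr (.inr (transGen_of_transGen_of_equiv hRE h₂ (hE.symm h₁)))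
  · exact .inr (.inl (transGen_of_transGen_of_equiv hRE h₁ h₂))
  · exact .inr (.inl (h₁.trans h₂))
  · exact comparableMod_of_transGen_of_transGen hE hRE hwf hpeak h₁ h₂
  · exact .inr (.inr (transGen_of_equiv_of_transGen hER (hE.symm h₂) h₁))
  · refine (comparableMod_of_transGen_of_transGen (R := Function.swap R) hE
      (fun _ _ _ h h' => hER (hE.symm h') h) hwf' ?_
      (transGen_swap.2 h₁) (transGen_swap.2 h₂)).of_swap
    exact fun _ _ _ h h' => ComparableMod.of_swap (hvalley h h')
  · exact .inr (.inr (h₂.trans h₁))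

end Confluence

/-! ### Galleries of divisors -/

namespace PositiveBraid

open Relation

variable {m : ℕ} {D : PositiveBraid m}

abbrev Divisor (D : PositiveBraid m) : Type := {x : PositiveBraid m // x ∣ D}

def Edge (i : Fin m) (x y : Divisor D) : Prop := y.1 = x.1 * gen i

def Link (i : Fin m) (x y : Divisor D) : Prop := Edge i x y ∨ Edge i y x

def Conn (k : ℕ) : Divisor D → Divisor D → Prop :=
  ReflTransGen fun x y => ∃ i : Fin m, k ≤ i ∧ Link i x y

/-- `y` is reached from `x` by one positive edge of index `k` and edges of larger index. -/
def Step (k : ℕ) (x y : Divisor D) : Prop :=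
  ∃ (x' y' : Divisor D) (i : Fin m), (i : ℕ) = k ∧ Conn (k + 1) x x' ∧ Edge i x' y' ∧
    Conn (k + 1) y' y

theorem Link.conn {i : Fin m} {k : ℕ} (hk : k ≤ i) {x y : Divisor D} (h : Link i x y) :
    Conn k x y :=
  .single ⟨i, hk, h⟩

theorem conn_equivalence (k : ℕ) : Equivalence (Conn (D := D) k) where
  refl _ := .refl
  symm {x y} h := by
    let r : Divisor D → Divisor D → Prop := fun x y => ∃ i : Fin m, k ≤ i ∧ Link i x y
    have : Std.Symm r := ⟨fun _ _ ⟨i, hi, h⟩ => ⟨i, hi, Or.symm h⟩⟩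
    exact (ReflTransGen.stdSymm (r := r)).symm x y h
  trans := ReflTransGen.trans

theorem Conn.mono {k l : ℕ} (hkl : k ≤ l) {x y : Divisor D} (h : Conn l x y) : Conn k x y :=
  ReflTransGen.mono (fun _ _ ⟨i, hi, h⟩ => ⟨i, hkl.trans hi, h⟩) _ _ h

theorem Step.of_conn_left {k : ℕ} {x y z : Divisor D} (h : Conn (k + 1) x y) (h' : Step k y z) :
    Step k x z := by
  obtain ⟨y', z', i, hi, h₁, h₂, h₃⟩ := h'
  exact ⟨y', z', i, hi, h.trans h₁, h₂, h₃⟩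

theorem Step.of_conn_right {k : ℕ} {x y z : Divisor D} (h : Step k x y) (h' : Conn (k + 1) y z) :
    Step k x z := by
  obtain ⟨x', y', i, hi, h₁, h₂, h₃⟩ := h
  exact ⟨x', y', i, hi, h₁, h₂, h₃.trans h'⟩

theorem potential_eq_of_conn {k : ℕ} {x y : Divisor D} (h : Conn (k + 1) x y) :
    potential k x.1 = potential k y.1 := by
  induction h with
  | refl => rfl
  | tail _ h ih =>
    obtain ⟨i, hi, h | h⟩ := h
    · rw [ih, h, potential_mul_gen_of_lt _ hi]
    · rw [ih, h, potential_mul_gen_of_lt _ hi]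

theorem Step.potential_lt {k : ℕ} {x y : Divisor D} (h : Step k x y) :
    potential k x.1 < potential k y.1 := by
  obtain ⟨x', y', i, rfl, h₁, h₂, h₃⟩ := h
  rw [potential_eq_of_conn h₁, ← potential_eq_of_conn h₃, h₂]
  exact potential_lt_mul_gen _ _

theorem step_wellFounded (k : ℕ) : WellFounded (Step (D := D) k) := by
  have := finite_dvd D
  let r : Divisor D → Divisor D → Prop := fun x y => potential k x.1 < potential k y.1
  have : IsTrans _ r := ⟨fun _ _ _ => lt_trans⟩
  have : Std.Irrefl r := ⟨fun _ => lt_irrefl _⟩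
  exact Subrelation.wf (fun h => h.potential_lt) (Finite.wellFounded_of_trans_of_irrefl r)

theorem swap_step_wellFounded (k : ℕ) : WellFounded (Function.swap (Step (D := D) k)) := by
  have := finite_dvd D
  let r : Divisor D → Divisor D → Prop := fun x y => potential k y.1 < potential k x.1
  have : IsTrans _ r := ⟨fun _ _ _ h h' => lt_trans h' h⟩
  have : Std.Irrefl r := ⟨fun _ => lt_irrefl _⟩
  exact Subrelation.wf (fun {x y} (h : Step k y x) => h.potential_lt)
    (Finite.wellFounded_of_trans_of_irrefl r)

theorem Edge.exists_back_far {k i : Fin m} (hki : Far k i) {x c d : Divisor D} (h : Edge k x c)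
    (h' : Link i c d) : ∃ y, Edge k y d ∧ Link i x y := by
  rcases h' with h' | h'
  · have e : d.1 = x.1 * gen i * gen k := by
      rw [h', h, mul_assoc, gen_comm hki, mul_assoc]
    exact ⟨⟨x.1 * gen i, (Dvd.intro _ e.symm).trans d.2⟩, e, .inl rfl⟩
  · obtain ⟨w, e₁, e₂⟩ := exists_of_mul_gen_eq_far hki (h.symm.trans h')
    exact ⟨⟨w, (Dvd.intro _ e₁.symm).trans x.2⟩, e₂, .inr e₁⟩

theorem Edge.exists_back_adj {k i : Fin m} (hki : (k : ℕ) + 1 = i) {y d e : Divisor D}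
    (h : Edge k y e) (h' : Edge i d e) : ∃ x, Edge k x d ∧ Step k x y := by
  obtain ⟨w, e₁, e₂⟩ := exists_of_mul_gen_eq_adj (.inl hki) (h.symm.trans h')
  let z' : Divisor D := ⟨w * gen k, (Dvd.intro _ e₁.symm).trans y.2⟩
  let x : Divisor D := ⟨w * gen i, (Dvd.intro _ e₂.symm).trans d.2⟩
  let z : Divisor D := ⟨w, (Dvd.intro _ rfl).trans x.2⟩
  exact ⟨x, e₂, z, z', k, rfl, Link.conn (i := i) hki.le (.inr rfl), rfl,
    Link.conn (i := i) hki.le (.inl e₁)⟩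

theorem Edge.exists_resolves {k i : Fin m} {c x d : Divisor D} (h : Edge k c x)
    (h' : Edge i c d) : ∃ u v, D = x.1 * u ∧ D = d.1 * v ∧ Resolves k i u v := by
  obtain ⟨u, hu⟩ := x.2
  obtain ⟨v, hv⟩ := d.2
  refine ⟨u, v, hu, hv, resolves (mul_left_cancel_of_eq c.1 ?_)⟩
  rw [← mul_assoc, ← mul_assoc, ← h, ← h', ← hu, ← hv]

theorem Edge.exists_forward_far {k i : Fin m} (hki : Far k i) {x c d : Divisor D}
    (h : Edge k c x) (h' : Link i c d) : ∃ y, Edge k d y ∧ Link i x y := by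
  rcases h' with h' | h'
  · obtain ⟨u, v, hu, hv, huv⟩ := h.exists_resolves h'
    obtain ⟨w, -, rfl⟩ := huv.of_far hki
    refine ⟨⟨d.1 * gen k, w, by simpa only [mul_assoc] using hv⟩, rfl, .inl ?_⟩
    change d.1 * gen k = x.1 * gen i
    rw [h, h', mul_assoc, ← gen_comm hki, mul_assoc]
  · have e : x.1 = d.1 * gen k * gen i := by
      rw [h, h', mul_assoc, ← gen_comm hki, mul_assoc]
    exact ⟨⟨d.1 * gen k, (Dvd.intro _ e.symm).trans x.2⟩, rfl, .inr e⟩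

theorem Edge.exists_forward_adj {k i : Fin m} (hki : (k : ℕ) + 1 = i) {x d e : Divisor D}
    (h : Edge k d x) (h' : Edge i d e) : ∃ y, Edge k e y ∧ Step k x y := by
  obtain ⟨u, v, hu, hv, huv⟩ := h.exists_resolves h'
  obtain ⟨w, rfl, rfl⟩ := huv.of_adj (.inl hki)
  let y : Divisor D := ⟨e.1 * gen k, gen i * w, by simpa only [mul_assoc] using hv⟩
  let z' : Divisor D := ⟨x.1 * gen i * gen k, w, by simpa only [mul_assoc] using hu⟩
  let z : Divisor D := ⟨x.1 * gen i, (Dvd.intro _ rfl).trans z'.2⟩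
  refine ⟨y, rfl, z, z', k, rfl, Link.conn (i := i) hki.le (.inl rfl), rfl,
    Link.conn (i := i) hki.le (.inr ?_)⟩
  change x.1 * gen i * gen k = e.1 * gen k * gen i
  rw [h, h']
  simp only [mul_assoc]
  rw [gen_braid (.inl hki)]

theorem Edge.left_unique {k : Fin m} {x y c : Divisor D} (h : Edge k x c) (h' : Edge k y c) :
    x = y :=
  Subtype.ext (mul_gen_right_cancel (h.symm.trans h'))

theorem Edge.right_unique {k : Fin m} {x y c : Divisor D} (h : Edge k c x) (h' : Edge k c y) :
    x = y :=
  Subtype.ext (h.trans h'.symm)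

theorem Conn.exists_lift {k : ℕ} {P : Divisor D → Divisor D → Prop}
    (hP : ∀ {i : Fin m}, k ≤ i → ∀ {x c d}, P x c → Link i c d → ∃ y, P y d ∧ Link i x y)
    {x c d : Divisor D} (h : P x c) (h' : Conn k c d) : ∃ y, P y d ∧ Conn k x y := by
  induction h' with
  | refl => exact ⟨x, h, .refl⟩
  | tail _ hl ih =>
    obtain ⟨y, hy, hxy⟩ := ih
    obtain ⟨i, hi, hl⟩ := hl
    obtain ⟨z, hz, hyz⟩ := hP hi hy hl
    exact ⟨z, hz, hxy.tail ⟨i, hi, hyz⟩⟩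

theorem Edge.exists_back_conn {k : Fin m} {x c d : Divisor D} (h : Edge k x c)
    (h' : Conn (k + 2) c d) : ∃ y, Edge k y d ∧ Conn (k + 2) x y :=
  h'.exists_lift (P := Edge k) (fun hi => Edge.exists_back_far (.inl hi)) h

theorem Edge.exists_forward_conn {k : Fin m} {x c d : Divisor D} (h : Edge k c x)
    (h' : Conn (k + 2) c d) : ∃ y, Edge k d y ∧ Conn (k + 2) x y :=
  h'.exists_lift (P := fun x c => Edge k c x) (fun hi => Edge.exists_forward_far (.inl hi)) h

theorem Edge.exists_back_step {k : Fin m} {y c d : Divisor D} (h : Edge k y d)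
    (h' : Step (k + 1) c d) : ∃ x, Edge k x c ∧ Step k x y := by
  obtain ⟨c', d', i, hi, h₁, h₂, h₃⟩ := h'
  obtain ⟨y', hy', hyy'⟩ := h.exists_back_conn ((conn_equivalence _).symm h₃)
  obtain ⟨x', hx', hs⟩ := hy'.exists_back_adj hi.symm h₂
  obtain ⟨x, hx, hxx'⟩ := hx'.exists_back_conn ((conn_equivalence _).symm h₁)
  exact ⟨x, hx, .of_conn_left (((conn_equivalence _).symm hxx').mono (by omega))
    (hs.of_conn_right (((conn_equivalence _).symm hyy').mono (by omega)))⟩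

theorem Edge.exists_forward_step {k : Fin m} {x c d : Divisor D} (h : Edge k c x)
    (h' : Step (k + 1) c d) : ∃ y, Edge k d y ∧ Step k x y := by
  obtain ⟨c', d', i, hi, h₁, h₂, h₃⟩ := h'
  obtain ⟨x', hx', hxx'⟩ := h.exists_forward_conn h₁
  obtain ⟨y', hy', hs⟩ := hx'.exists_forward_adj hi.symm h₂
  obtain ⟨y, hy, hyy'⟩ := hy'.exists_forward_conn h₃
  exact ⟨y, hy, .of_conn_left (hxx'.mono (by omega)) (hs.of_conn_right (hyy'.mono (by omega)))⟩

theorem Edge.exists_back_transGen {k : Fin m} {y c d : Divisor D} (h : Edge k y d)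
    (h' : TransGen (Step (k + 1)) c d) : ∃ x, Edge k x c ∧ TransGen (Step k) x y := by
  induction h' using TransGen.head_induction_on with
  | single hs =>
    obtain ⟨x, hx, hxy⟩ := h.exists_back_step hs
    exact ⟨x, hx, .single hxy⟩
  | head hs _ ih =>
    obtain ⟨z, hz, hzy⟩ := ih
    obtain ⟨x, hx, hxz⟩ := hz.exists_back_step hs
    exact ⟨x, hx, .head hxz hzy⟩

theorem Edge.exists_forward_transGen {k : Fin m} {x c d : Divisor D} (h : Edge k c x)
    (h' : TransGen (Step (k + 1)) c d) : ∃ y, Edge k d y ∧ TransGen (Step k) x y := by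
  induction h' with
  | single hs =>
    obtain ⟨y, hy, hxy⟩ := h.exists_forward_step hs
    exact ⟨y, hy, .single hxy⟩
  | tail _ hs ih =>
    obtain ⟨z, hz, hxz⟩ := ih
    obtain ⟨y, hy, hzy⟩ := hz.exists_forward_step hs
    exact ⟨y, hy, .tail hxz hzy⟩

abbrev Comparable (k : ℕ) : Divisor D → Divisor D → Prop :=
  ComparableMod (Conn (k + 1)) (Step k)

theorem Edge.comparable_of_back {k : Fin m} {a b c d : Divisor D} (ha : Edge k a c)
    (hb : Edge k b d) (h : Comparable (k + 1) c d) : Comparable k a b := by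
  rcases h with h | h | h
  · obtain ⟨y, hy, hay⟩ := ha.exists_back_conn h
    exact .inl (hy.left_unique hb ▸ hay.mono (by omega))
  · obtain ⟨x, hx, hxb⟩ := hb.exists_back_transGen h
    exact .inr (.inl (hx.left_unique ha ▸ hxb))
  · obtain ⟨x, hx, hxa⟩ := ha.exists_back_transGen h
    exact .inr (.inr (hx.left_unique hb ▸ hxa))

theorem Edge.comparable_of_forward {k : Fin m} {a b c d : Divisor D} (ha : Edge k c a)
    (hb : Edge k d b) (h : Comparable (k + 1) c d) : Comparable k a b := by
  rcases h with h | h | h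
  · obtain ⟨y, hy, hay⟩ := ha.exists_forward_conn h
    exact .inl (hy.right_unique hb ▸ hay.mono (by omega))
  · obtain ⟨x, hx, hxb⟩ := ha.exists_forward_transGen h
    exact .inr (.inl (hx.right_unique hb ▸ hxb))
  · obtain ⟨x, hx, hxa⟩ := hb.exists_forward_transGen h
    exact .inr (.inr (hx.right_unique ha ▸ hxa))

theorem Comparable.of_conn {k : ℕ} {a a' b b' : Divisor D} (h : Comparable k a' b')
    (ha : Conn (k + 1) a a') (hb : Conn (k + 1) b b') : Comparable k a b := by
  have hER ⦃a b c : Divisor D⦄ : Conn (k + 1) a b → Step k b c → Step k a c :=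
    Step.of_conn_left
  have hRE ⦃a b c : Divisor D⦄ : Step k a b → Conn (k + 1) b c → Step k a c :=
    Step.of_conn_right
  have hE := conn_equivalence (D := D) (k + 1)
  rcases h with h | h | h
  · exact .inl (hE.trans ha (hE.trans h (hE.symm hb)))
  · exact .inr (.inl (transGen_of_equiv_of_transGen hER ha
      (transGen_of_transGen_of_equiv hRE h (hE.symm hb))))
  · exact .inr (.inr (transGen_of_equiv_of_transGen hER hb
      (transGen_of_transGen_of_equiv hRE h (hE.symm ha))))

theorem comparable_of_conn {k : ℕ} {x y : Divisor D} (h : Conn k x y) : Comparable k x y := by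
  obtain ⟨j, hj⟩ : ∃ j, m ≤ k + j := ⟨m, by omega⟩
  induction j generalizing k x y with
  | zero =>
    rcases ReflTransGen.cases_head h with rfl | ⟨_, ⟨i, hi, _⟩, _⟩
    · exact .inl .refl
    · omega
  | succ j ih =>
    have hE := conn_equivalence (D := D) (k + 1)
    have htrans {a b c : Divisor D} : Comparable k a b → Comparable k b c → Comparable k a c := by
      refine ComparableMod.trans (R := Step k) hE (fun _ _ _ => Step.of_conn_left)
        (fun _ _ _ => Step.of_conn_right) (step_wellFounded k)
        (swap_step_wellFounded k) ?_ ?_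
      · rintro a b c ⟨a', c', i, rfl, h₁, h₂, h₃⟩ ⟨b', d', i', hi, h₄, h₅, h₆⟩
        obtain rfl := Fin.ext hi
        exact (h₂.comparable_of_back h₅ (ih (h₃.trans (hE.symm h₆)) (by omega))).of_conn h₁ h₄
      · rintro a b c ⟨c', a', i, rfl, h₁, h₂, h₃⟩ ⟨d', b', i', hi, h₄, h₅, h₆⟩
        obtain rfl := Fin.ext hi
        exact (h₂.comparable_of_forward h₅ (ih ((hE.symm h₁).trans h₄) (by omega))).of_conn
          (hE.symm h₃) (hE.symm h₆)
    induction h with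
    | refl => exact .inl .refl
    | tail _ hl ihh =>
      refine htrans ihh ?_
      obtain ⟨i, hi, hl⟩ := hl
      rcases hi.eq_or_lt with rfl | hi
      · rcases hl with hl | hl
        · exact .inr (.inl (.single ⟨_, _, i, rfl, .refl, hl, .refl⟩))
        · exact .inr (.inr (.single ⟨_, _, i, rfl, .refl, hl, .refl⟩))
      · exact .inl (hl.conn hi)

theorem conn_one (x : PositiveBraid m) (hx : x ∣ D) : Conn 0 ⟨1, one_dvd D⟩ ⟨x, hx⟩ := by
  induction x using induction_right with
  | one => exact .refl
  | mul_gen x i ih => exact (ih (dvd_of_mul_right_dvd hx)).tail ⟨i, Nat.zero_le _, .inl rfl⟩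

/-! ### From positive braids to the braid group -/

theorem braidGen_braid (i j : Fin m) (h : (i : ℕ) + 1 = j) :
    braidGen i * braidGen j * braidGen i = braidGen j * braidGen i * braidGen j :=
  mul_inv_eq_one.1 (PresentedGroup.one_of_mem (rels := braidRels m) (.inl ⟨i, j, h, rfl⟩))

theorem braidGen_comm (i j : Fin m) (h : (i : ℕ) + 2 ≤ j) :
    braidGen i * braidGen j = braidGen j * braidGen i :=
  mul_inv_eq_one.1 (PresentedGroup.one_of_mem (rels := braidRels m) (.inr ⟨i, j, h, rfl⟩))

def toBraidGroup (m : ℕ) : PositiveBraid m →* BraidGroup m :=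
  liftHom braidGen braidGen_braid braidGen_comm

theorem toBraidGroup_gen (i : Fin m) : toBraidGroup m (gen i) = braidGen i := rfl

theorem exists_mul_eq_toBraidGroup (β : BraidGroup m) :
    ∃ a b : PositiveBraid m, (∀ x, Commute a x) ∧ toBraidGroup m a * β = toBraidGroup m b := by
  obtain ⟨Z, hZ, hdvd⟩ := exists_central_multiple m
  have hβ : β ∈ Subgroup.closure (Set.range (PresentedGroup.of (rels := braidRels m))) := by
    rw [PresentedGroup.closure_range_of]; trivial
  induction hβ using Subgroup.closure_induction_right with
  | one => exact ⟨1, 1, fun x => Commute.one_left x, by simp⟩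
  | mul_right β _ t ht ih =>
    obtain ⟨a, b, ha, hab⟩ := ih
    obtain ⟨i, rfl⟩ := ht
    exact ⟨a, b * gen i, ha, by rw [← mul_assoc, hab, map_mul]; rfl⟩
  | mul_inv_cancel β _ t ht ih =>
    obtain ⟨a, b, ha, hab⟩ := ih
    obtain ⟨i, rfl⟩ := ht
    obtain ⟨y, rfl⟩ := hdvd i
    have hy : y * gen i = gen i * y :=
      gen_mul_left_cancel (by rw [← mul_assoc]; exact (hZ (gen i)).eq)
    refine ⟨gen i * y * a, b * y, fun x => (hZ x).mul_left (ha x), ?_⟩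
    change _ * (β * (toBraidGroup m (gen i))⁻¹) = _
    rw [← mul_assoc, mul_inv_eq_iff_eq_mul, map_mul, mul_assoc, hab, ← map_mul, ← map_mul,
      (hZ b).eq, mul_assoc, hy]

end PositiveBraid

section ProductForm

variable {G : Type*} [Group G]

def IsProductForm (H : Subgroup G) (t g : G) : Prop :=
  ∃ l : ℕ, 1 ≤ l ∧ ∃ α : ℕ → G, (∀ i ≤ l, α i ∈ H) ∧
    g = ((List.range l).map (fun i => α i * t)).prod * α l

theorem isProductForm_mul_mul {H : Subgroup G} {t h h' : G} (hh : h ∈ H) (hh' : h' ∈ H) :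
    IsProductForm H t (h * t * h') := by
  refine ⟨1, le_rfl, fun i => if i = 0 then h else h', fun i _ => ?_, by simp⟩
  dsimp only
  split_ifs <;> assumption

theorem IsProductForm.mul_mul_mul {H : Subgroup G} {t g h h' : G} (hg : IsProductForm H t g)
    (hh : h ∈ H) (hh' : h' ∈ H) : IsProductForm H t (g * (h * t * h')) := by
  obtain ⟨l, hl, α, hα, rfl⟩ := hg
  refine ⟨l + 1, by omega, fun i => if i < l then α i else if i = l then α l * h else h',
    fun i _ => ?_, ?_⟩
  · dsimp only
    split_ifs with h₁ h₂
    · exact hα i h₁.le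
    · exact H.mul_mem (hα l le_rfl) hh
    · exact hh'
  · have : (List.range l).map
        (fun i => (if i < l then α i else if i = l then α l * h else h') * t) =
        (List.range l).map (fun i => α i * t) :=
      List.map_congr_left fun i hi => by rw [if_pos (List.mem_range.1 hi)]
    rw [List.range_succ, List.map_append, this]
    simp [mul_assoc]

theorem isProductForm_of_transGen {α : Type*} {R : α → α → Prop} {H : Subgroup G} {t : G}
    {f : α → G} (hR : ∀ x y, R x y → ∃ h ∈ H, ∃ h' ∈ H, (f x)⁻¹ * f y = h * t * h') {x y : α}
    (hxy : Relation.TransGen R x y) : IsProductForm H t ((f x)⁻¹ * f y) := by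
  induction hxy with
  | single h =>
    obtain ⟨h, hh, h', hh', e⟩ := hR _ _ h
    rw [e]
    exact isProductForm_mul_mul hh hh'
  | @tail y z _ h ih =>
    obtain ⟨h, hh, h', hh', e⟩ := hR _ _ h
    have := ih.mul_mul_mul hh hh'
    rwa [← e, mul_assoc, mul_inv_cancel_left] at this

end ProductForm

namespace PositiveBraid

variable {m : ℕ} {D : PositiveBraid m}

theorem Conn.inv_mul_mem {k : ℕ} {x y : Divisor D} (h : Conn k x y) :
    (toBraidGroup m x.1)⁻¹ * toBraidGroup m y.1 ∈
      Subgroup.closure (braidGen '' {i : Fin m | k ≤ (i : ℕ)}) := by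
  induction h with
  | refl => simp
  | @tail y z _ h ih =>
    obtain ⟨i, hi, h⟩ := h
    have hmem : toBraidGroup m (gen i) ∈ Subgroup.closure (braidGen '' {i : Fin m | k ≤ (i : ℕ)}) :=
      Subgroup.subset_closure ⟨i, hi, rfl⟩
    rcases h with h | h
    · rw [h, map_mul, ← mul_assoc]
      exact Subgroup.mul_mem _ ih hmem
    · rw [h, map_mul, ← mul_assoc] at ih
      simpa using Subgroup.mul_mem _ ih (Subgroup.inv_mem _ hmem)

theorem Step.exists_inv_mul_eq {k : Fin m} {x y : Divisor D} (h : Step k x y) :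
    ∃ h ∈ Subgroup.closure (braidGen '' {i : Fin m | (k : ℕ) + 1 ≤ i}),
      ∃ h' ∈ Subgroup.closure (braidGen '' {i : Fin m | (k : ℕ) + 1 ≤ i}),
        (toBraidGroup m x.1)⁻¹ * toBraidGroup m y.1 = h * braidGen k * h' := by
  obtain ⟨x', y', i, hi, h₁, h₂, h₃⟩ := h
  obtain rfl := Fin.ext hi
  refine ⟨_, h₁.inv_mul_mem, _, h₃.inv_mul_mem, ?_⟩
  rw [h₂, map_mul, toBraidGroup_gen]
  group

end PositiveBraid

theorem dehornoy_trichotomy (n : ℕ) (hn : 2 ≤ n) (β : BraidGroup (n - 1)) :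
    β ∈ Subgroup.closure (braidGen '' {k : Fin (n - 1) | 1 ≤ (k : ℕ)}) ∨
    (∃ l : ℕ, 1 ≤ l ∧ ∃ α : ℕ → BraidGroup (n - 1),
      (∀ i ≤ l, α i ∈ Subgroup.closure (braidGen '' {k : Fin (n - 1) | 1 ≤ (k : ℕ)})) ∧
      β = ((List.range l).map
            (fun i => α i * braidGen (⟨0, by omega⟩ : Fin (n - 1)))).prod * α l) ∨
    (∃ l : ℕ, 1 ≤ l ∧ ∃ α : ℕ → BraidGroup (n - 1),
      (∀ i ≤ l, α i ∈ Subgroup.closure (braidGen '' {k : Fin (n - 1) | 1 ≤ (k : ℕ)})) ∧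
      β = ((List.range l).map
            (fun i => α i * (braidGen (⟨0, by omega⟩ : Fin (n - 1)))⁻¹)).prod * α l) := by
  obtain ⟨a, b, ha, hab⟩ := PositiveBraid.exists_mul_eq_toBraidGroup β
  obtain rfl : β = (PositiveBraid.toBraidGroup (n - 1) a)⁻¹ *
      PositiveBraid.toBraidGroup (n - 1) b := by rw [← hab, inv_mul_cancel_left]
  let x : PositiveBraid.Divisor (a * b) := ⟨a, dvd_mul_right a b⟩
  let y : PositiveBraid.Divisor (a * b) := ⟨b, a, (ha b).eq⟩
  let f : PositiveBraid.Divisor (a * b) → BraidGroup (n - 1) :=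
    fun z => PositiveBraid.toBraidGroup (n - 1) z.1
  let s : Fin (n - 1) := ⟨0, by omega⟩
  have hconn : PositiveBraid.Conn 0 x y :=
    ((PositiveBraid.conn_equivalence 0).symm (PositiveBraid.conn_one a x.2)).trans
      (PositiveBraid.conn_one b y.2)
  rcases PositiveBraid.comparable_of_conn hconn with h | h | h
  · exact .inl h.inv_mul_mem
  · exact .inr (.inl (isProductForm_of_transGen (f := f)
      (fun z w hs => PositiveBraid.Step.exists_inv_mul_eq (k := s) hs) h))
  · refine .inr (.inr (isProductForm_of_transGen (f := f) (x := x) (y := y) (fun z w hs => ?_)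
      (Relation.transGen_swap.2 h)))
    obtain ⟨h, hh, h', hh', e⟩ := PositiveBraid.Step.exists_inv_mul_eq (k := s) hs
    refine ⟨h'⁻¹, inv_mem hh', h⁻¹, inv_mem hh, ?_⟩
    have e' := congrArg (·⁻¹) e
    simpa [f, s, mul_assoc] using e'
end
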